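/- arXiv:1412.4706 — 2 statements merged into one kernel-verified Lean document; each statement's English description precedes it below -/
import Mathlib

section
/- Let N ≥ 2 be an integer, γ > −N, ν ∈ (0,2), and let f : ℝ^N → [0,∞) be measurable satisfying the macroscopic bounds with constants M₁, M₀, E₀, H₀. Suppose there is a point v ∈ ℝ^N and m > 0 with f(v) = m and f(v') ≤ m for all v' ∈ ℝ^N. Then ∫_{ℝ^N} (m − f(v')) K̄_f(v,v') dv' ≥ c m^{1+ν/N} (1+|v|)^{ν(1+1/N)+γ}, where c > 0 depends only on N, γ, ν, M₀, M₁, E₀ and H₀. -/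
open MeasureTheory Metric Set
open scoped ENNReal RealInnerProductSpace

noncomputable section

/-- The Boltzmann kernel
`K̄_f(v,v') = |v'-v|^{-N-ν} ∫_{w ⊥ (v'-v)} f(v+w) |w|^{γ+ν+1} dS(w)`,
where the inner integral is over the hyperplane orthogonal to `v' - v` with respect to the
`(N-1)`-dimensional Hausdorff measure. -/
def Kbar (N : ℕ) (γ ν : ℝ) (f : EuclideanSpace ℝ (Fin N) → ℝ)
    (v v' : EuclideanSpace ℝ (Fin N)) : ℝ≥0∞ :=
  ENNReal.ofReal (‖v' - v‖ ^ (-(N : ℝ) - ν)) *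
    ∫⁻ w in {w : EuclideanSpace ℝ (Fin N) | ⟪w, v' - v⟫ = 0},
      ENNReal.ofReal (f (v + w) * ‖w‖ ^ (γ + ν + 1)) ∂(μH[(N : ℝ) - 1])

/-- The entropy bound `∫ f log f ≤ H₀`, stated in the extended sense: the positive part of
the integral minus the negative part is at most `H₀` (the inequality is arranged in `ℝ≥0∞`
so that it is meaningful even when the integral is `-∞`). -/
def EntropyLE (N : ℕ) (f : EuclideanSpace ℝ (Fin N) → ℝ) (H₀ : ℝ) : Prop :=
  (∫⁻ v, ENNReal.ofReal (f v * Real.log (f v))) + ENNReal.ofReal (-H₀) ≤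
    (∫⁻ v, ENNReal.ofReal (-(f v * Real.log (f v)))) + ENNReal.ofReal H₀

/-- The macroscopic bounds for the Boltzmann equation: mass between `M₁` and `M₀`,
energy at most `E₀` and entropy at most `H₀`. -/
def MacroBounds (N : ℕ) (f : EuclideanSpace ℝ (Fin N) → ℝ) (M₁ M₀ E₀ H₀ : ℝ) : Prop :=
  ENNReal.ofReal M₁ ≤ (∫⁻ v, ENNReal.ofReal (f v)) ∧
  (∫⁻ v, ENNReal.ofReal (f v)) ≤ ENNReal.ofReal M₀ ∧
  (∫⁻ v, ENNReal.ofReal (‖v‖ ^ 2 * f v)) ≤ ENNReal.ofReal E₀ ∧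
  EntropyLE N f H₀

variable {n : ℕ}

/-- The point of `ℝ^(n+1)` with `i`-th coordinate `t` and remaining coordinates `x`. -/
def insertCoord {n : ℕ} (i : Fin (n + 1)) (t : ℝ) (x : Fin n → ℝ) :
    EuclideanSpace ℝ (Fin (n + 1)) :=
  WithLp.toLp 2 (Fin.insertNth (α := fun _ => ℝ) i t x)

/-- The point of the hyperplane `h^⊥` whose coordinates other than the `i`-th are `x`. -/
def graphPoint {n : ℕ} (i : Fin (n + 1)) (h : EuclideanSpace ℝ (Fin (n + 1))) (x : Fin n → ℝ) :
    EuclideanSpace ℝ (Fin (n + 1)) :=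
  insertCoord i (-(∑ k, x k * h (i.succAbove k)) / h i) x

@[simp] lemma insertCoord_same (i : Fin (n + 1)) (t : ℝ) (x : Fin n → ℝ) :
    insertCoord i t x i = t := by
  simp [insertCoord]

@[simp] lemma insertCoord_succAbove (i : Fin (n + 1)) (t : ℝ) (x : Fin n → ℝ) (k : Fin n) :
    insertCoord i t x (i.succAbove k) = x k := by
  simp [insertCoord]

lemma inner_graphPoint {i : Fin (n + 1)} {h : EuclideanSpace ℝ (Fin (n + 1))} (hi : h i ≠ 0)
    (x : Fin n → ℝ) : ⟪graphPoint i h x, h⟫ = 0 := by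
  rw [PiLp.inner_apply, Fin.sum_univ_succAbove _ i]
  simp only [graphPoint, insertCoord_same, insertCoord_succAbove, RCLike.inner_apply,
    conj_trivial]
  rw [mul_div_cancel₀ _ hi]
  simp [mul_comm]

lemma measurable_insertCoord (i : Fin (n + 1)) :
    Measurable fun p : ℝ × (Fin n → ℝ) => insertCoord i p.1 p.2 :=
  (WithLp.measurable_toLp 2 _).comp
    (MeasurableEquiv.piFinSuccAbove (fun _ : Fin (n + 1) => ℝ) i).symm.measurable

lemma measurable_graphPoint (i : Fin (n + 1)) :
    Measurable fun p : EuclideanSpace ℝ (Fin (n + 1)) × (Fin n → ℝ) => graphPoint i p.1 p.2 := by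
  refine (measurable_insertCoord i).comp (Measurable.prodMk ?_ measurable_snd)
  fun_prop

lemma lintegral_eq_insertCoord (i : Fin (n + 1)) {F : EuclideanSpace ℝ (Fin (n + 1)) → ℝ≥0∞}
    (hF : Measurable F) : ∫⁻ y, F y = ∫⁻ x : Fin n → ℝ, ∫⁻ t : ℝ, F (insertCoord i t x) := by
  have h1 := (PiLp.volume_preserving_toLp (Fin (n + 1))).lintegral_comp hF
  have h2 := ((volume_preserving_piFinSuccAbove (fun _ : Fin (n + 1) => ℝ) i).symm).lintegral_comp
    (hF.comp (WithLp.measurable_toLp 2 (Fin (n + 1) → ℝ)))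
  rw [← h1]
  refine h2.symm.trans ?_
  rw [Measure.volume_eq_prod, lintegral_prod_symm]
  · rfl
  · exact (hF.comp (measurable_insertCoord i)).aemeasurable

lemma lintegral_graphPoint_le_hyperplane {i : Fin (n + 1)} {h : EuclideanSpace ℝ (Fin (n + 1))}
    (hi : h i ≠ 0) {φ : EuclideanSpace ℝ (Fin (n + 1)) → ℝ≥0∞} (hφ : Measurable φ) :
    ∫⁻ x, φ (graphPoint i h x) ≤
      ∫⁻ w in {w : EuclideanSpace ℝ (Fin (n + 1)) | ⟪w, h⟫ = 0}, φ w
        ∂(μH[((n + 1 : ℕ) : ℝ) - 1]) := by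
  have hg : Measurable (graphPoint i h) :=
    (measurable_graphPoint i).comp (measurable_const.prodMk measurable_id)
  rw [← lintegral_map hφ hg]
  refine lintegral_mono' ?_ le_rfl
  refine Measure.le_iff.2 fun A hA => ?_
  rw [Measure.map_apply hg hA, Measure.restrict_apply hA]
  let P : EuclideanSpace ℝ (Fin (n + 1)) → Fin n → ℝ := fun w k => w (i.succAbove k)
  have hP : LipschitzWith 1 P := by
    refine LipschitzWith.of_dist_le_mul fun x y => ?_
    rw [NNReal.coe_one, one_mul, dist_pi_le_iff dist_nonneg]
    intro k
    rw [dist_eq_norm, dist_eq_norm]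
    exact PiLp.norm_apply_le (x - y) (i.succAbove k)
  have hn : ((n + 1 : ℕ) : ℝ) - 1 = Fintype.card (Fin n) := by simp
  rw [hn, ← hausdorffMeasure_pi_real]
  calc μH[(Fintype.card (Fin n) : ℝ)] (graphPoint i h ⁻¹' A)
      ≤ μH[(Fintype.card (Fin n) : ℝ)] (P '' (A ∩ {w | ⟪w, h⟫ = 0})) := by
        refine measure_mono fun x hx => ⟨graphPoint i h x, ⟨hx, inner_graphPoint hi x⟩, ?_⟩
        ext k
        simp [P, graphPoint]
    _ ≤ _ := by
        simpa using hP.hausdorffMeasure_image_le (Nat.cast_nonneg _) (A ∩ {w | ⟪w, h⟫ = 0})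

lemma lintegral_comp_affine {g : ℝ → ℝ≥0∞} (hg : Measurable g) {c : ℝ} (hc : c ≠ 0) (d : ℝ) :
    ∫⁻ t, g t = ENNReal.ofReal |c| * ∫⁻ s, g (c * s + d) := by
  have hgd : Measurable fun t => g (t + d) := hg.comp (measurable_add_const d)
  rw [← lintegral_add_right_eq_self g d]
  conv_lhs => rw [← Real.smul_map_volume_mul_left hc]
  rw [lintegral_smul_measure, lintegral_map hgd (measurable_const_mul c), smul_eq_mul]

lemma sum_mul_insertCoord (i : Fin (n + 1)) (k : Fin n) (t : ℝ) (x y : Fin n → ℝ) :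
    ∑ l, x l * insertCoord (i.succAbove k) t y (i.succAbove l) =
      t * x k + ∑ l, x l * insertCoord (i.succAbove k) 0 y (i.succAbove l) := by
  have key : ∀ l, insertCoord (i.succAbove k) t y (i.succAbove l) =
      (if l = k then t else 0) + insertCoord (i.succAbove k) 0 y (i.succAbove l) := by
    intro l
    rcases eq_or_ne l k with rfl | hl
    · simp
    · obtain ⟨z, hz⟩ := Fin.exists_succAbove_eq
        (fun e => hl (Fin.succAbove_right_injective e) : i.succAbove l ≠ i.succAbove k)
      rw [← hz]
      simp [hl]
  simp_rw [key, mul_add, Finset.sum_add_distrib]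
  simp [mul_comm]

/-- Exchanging the roles of the two variables on `{(h, w) | h ⊥ w}`. -/
lemma lintegral_graphPoint_swap_le {i j : Fin (n + 1)} (k l : Fin n) (hj : i.succAbove k = j)
    (hi : j.succAbove l = i) {β φ : EuclideanSpace ℝ (Fin (n + 1)) → ℝ≥0∞}
    (hβ : Measurable β) (hφ : Measurable φ) :
    ∫⁻ w, φ w * ∫⁻ y, ENNReal.ofReal (|y l| / |w j|) * β (graphPoint j w y) ≤
      ∫⁻ h, β h * ∫⁻ x, φ (graphPoint i h x) := by
  have mβ := hβ.comp (measurable_graphPoint j)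
  have mφ := hφ.comp (measurable_graphPoint i)
  have mL : Measurable fun p : EuclideanSpace ℝ (Fin (n + 1)) × (Fin n → ℝ) =>
      φ p.1 * (ENNReal.ofReal (|p.2 l| / |p.1 j|) * β (graphPoint j p.1 p.2)) := by
    refine (hφ.comp measurable_fst).mul (Measurable.mul ?_ mβ)
    fun_prop
  have mR : Measurable fun p : EuclideanSpace ℝ (Fin (n + 1)) × (Fin n → ℝ) =>
      β p.1 * φ (graphPoint i p.1 p.2) := (hβ.comp measurable_fst).mul mφ
  have eL : ∀ w, φ w * ∫⁻ y, ENNReal.ofReal (|y l| / |w j|) * β (graphPoint j w y) =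
      ∫⁻ y, φ w * (ENNReal.ofReal (|y l| / |w j|) * β (graphPoint j w y)) := fun w =>
    (lintegral_const_mul _ (by
      refine Measurable.mul ?_ (mβ.comp measurable_prodMk_left)
      fun_prop)).symm
  have eR : ∀ h, β h * ∫⁻ x, φ (graphPoint i h x) = ∫⁻ x, β h * φ (graphPoint i h x) := fun h =>
    (lintegral_const_mul _ (mφ.comp measurable_prodMk_left)).symm
  simp_rw [eL, eR]
  rw [lintegral_eq_insertCoord i mL.lintegral_prod_right', lintegral_eq_insertCoord j
    mR.lintegral_prod_right']
  have sL : ∀ x : Fin n → ℝ, ∫⁻ s : ℝ, ∫⁻ y, φ (insertCoord i s x) *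
      (ENNReal.ofReal (|y l| / |insertCoord i s x j|) * β (graphPoint j (insertCoord i s x) y)) =
      ∫⁻ y, ∫⁻ s : ℝ, φ (insertCoord i s x) *
      (ENNReal.ofReal (|y l| / |insertCoord i s x j|) *
        β (graphPoint j (insertCoord i s x) y)) := by
    intro x
    refine lintegral_lintegral_swap (Measurable.aemeasurable ?_)
    exact mL.comp ((((measurable_insertCoord i).comp
      (measurable_fst.prodMk measurable_const)).prodMk measurable_snd) :
        Measurable fun q : ℝ × (Fin n → ℝ) => (insertCoord i q.1 x, q.2))
  have sR : ∀ y : Fin n → ℝ, ∫⁻ t : ℝ, ∫⁻ x, β (insertCoord j t y) *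
      φ (graphPoint i (insertCoord j t y) x) =
      ∫⁻ x, ∫⁻ t : ℝ, β (insertCoord j t y) * φ (graphPoint i (insertCoord j t y) x) := by
    intro y
    refine lintegral_lintegral_swap (Measurable.aemeasurable ?_)
    exact mR.comp ((((measurable_insertCoord j).comp
      (measurable_fst.prodMk measurable_const)).prodMk measurable_snd) :
        Measurable fun q : ℝ × (Fin n → ℝ) => (insertCoord j q.1 y, q.2))
  simp_rw [sL, sR]
  have mT : Measurable fun q : ((Fin n → ℝ) × (Fin n → ℝ)) × ℝ =>
      β (insertCoord j q.2 q.1.1) * φ (graphPoint i (insertCoord j q.2 q.1.1) q.1.2) :=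
    mR.comp ((((measurable_insertCoord j).comp
      (measurable_snd.prodMk (measurable_fst.comp measurable_fst))).prodMk
        (measurable_snd.comp measurable_fst)) :
        Measurable fun q : ((Fin n → ℝ) × (Fin n → ℝ)) × ℝ =>
          (insertCoord j q.2 q.1.1, q.1.2))
  rw [lintegral_lintegral_swap (μ := volume) (ν := volume) (f := fun (y x : Fin n → ℝ) =>
    ∫⁻ t : ℝ, β (insertCoord j t y) * φ (graphPoint i (insertCoord j t y) x))
    mT.lintegral_prod_right'.aemeasurable]
  refine lintegral_mono fun x => lintegral_mono fun y => ?_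
  have hxj : ∀ s, insertCoord i s x j = x k := fun s => by rw [← hj]; simp
  have hyi : ∀ t, insertCoord j t y i = y l := fun t => by rw [← hi]; simp
  simp only [hxj]
  rcases eq_or_ne (x k) 0 with hb | hb
  · simp [hb]
  rcases eq_or_ne (y l) 0 with ha | ha
  · simp [ha]
  have hA : ∑ a, x a * insertCoord j 0 y (i.succAbove a) =
      ∑ a, y a * insertCoord i 0 x (j.succAbove a) := by
    have e1 : ∑ a, insertCoord i 0 x a * insertCoord j 0 y a =
        ∑ a, x a * insertCoord j 0 y (i.succAbove a) := by
      rw [Fin.sum_univ_succAbove _ i]; simp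
    have e2 : ∑ a, insertCoord i 0 x a * insertCoord j 0 y a =
        ∑ a, y a * insertCoord i 0 x (j.succAbove a) := by
      rw [Fin.sum_univ_succAbove _ j]; simp [mul_comm]
    rw [← e1, e2]
  have g1 : ∀ t, graphPoint i (insertCoord j t y) x =
      insertCoord i (-(t * x k + ∑ a, x a * insertCoord j 0 y (i.succAbove a)) / y l) x := by
    intro t
    have := sum_mul_insertCoord i k t x y
    rw [hj] at this
    rw [graphPoint, this, hyi]
  have g2 : ∀ s, graphPoint j (insertCoord i s x) y =
      insertCoord j (-(s * y l + ∑ a, x a * insertCoord j 0 y (i.succAbove a)) / x k) y := by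
    intro s
    have := sum_mul_insertCoord j l s y x
    rw [hi] at this
    rw [graphPoint, this, hxj, hA]
  set A := ∑ a, x a * insertCoord j 0 y (i.succAbove a)
  have mt : Measurable fun t : ℝ => β (insertCoord j t y) * φ (graphPoint i (insertCoord j t y) x) :=
    mT.comp (measurable_prodMk_left (x := (y, x)))
  rw [lintegral_comp_affine mt (div_ne_zero (neg_ne_zero.2 ha) hb) (-A / x k), ← lintegral_const_mul]
  · refine lintegral_mono fun s => le_of_eq ?_
    have e1 : -y l / x k * s + -A / x k = -(s * y l + A) / x k := by ring
    have e2 : -((-(s * y l + A) / x k) * x k + A) / y l = s := by field_simp; ring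
    simp only [g1, g2]
    rw [e1, e2, abs_div, abs_neg]
    ring
  · exact mt.comp (by fun_prop)

lemma setLIntegral_ofReal_le_div {α : Type*} [MeasurableSpace α] {μ : Measure α} {f g : α → ℝ}
    {T : Set α} (hT : MeasurableSet T) {ℓ K : ℝ} (hℓ : 0 < ℓ) (hf : Measurable f)
    (hfg : ∀ x ∈ T, ℓ * f x ≤ g x) (hg : ∫⁻ x, ENNReal.ofReal (g x) ∂μ ≤ ENNReal.ofReal K) :
    ∫⁻ x in T, ENNReal.ofReal (f x) ∂μ ≤ ENNReal.ofReal (K / ℓ) := by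
  rw [ENNReal.ofReal_div_of_pos hℓ, ENNReal.le_div_iff_mul_le (by simp [hℓ]) (by simp), mul_comm,
    ← lintegral_const_mul _ hf.ennreal_ofReal]
  refine le_trans ?_ hg
  refine (setLIntegral_mono' hT fun x hx => ?_).trans (setLIntegral_le_lintegral T _)
  rw [← ENNReal.ofReal_mul hℓ.le]
  exact ENNReal.ofReal_le_ofReal (hfg x hx)

lemma Real.neg_mul_log_le {x : ℝ} (hx : 0 ≤ x) (a : ℝ) :
    -(x * Real.log x) ≤ a * x + Real.exp (-a) := by
  rcases hx.eq_or_lt with rfl | hx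
  · simp [Real.exp_nonneg]
  · have h := Real.add_one_le_exp (-a - Real.log x)
    rw [Real.exp_sub, Real.exp_log hx, le_div_iff₀ hx] at h
    nlinarith

lemma lintegral_exp_neg_sq_norm_lt_top (N : ℕ) :
    ∫⁻ x : EuclideanSpace ℝ (Fin N), ENNReal.ofReal (Real.exp (-‖x‖ ^ 2)) < ∞ := by
  have h := GaussianFourier.integral_rexp_neg_mul_sq_norm (V := EuclideanSpace ℝ (Fin N)) one_pos
  have hi : Integrable fun x : EuclideanSpace ℝ (Fin N) => Real.exp (-1 * ‖x‖ ^ 2) := by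
    refine Integrable.of_integral_ne_zero ?_
    rw [h]
    positivity
  simpa using hi.lintegral_lt_top

/-- The entropy and energy bounds control the positive part of `f log f`. -/
lemma exists_lintegral_mul_log_le (N : ℕ) (M₁ M₀ E₀ H₀ : ℝ) :
    ∃ K : ℝ, ∀ f : EuclideanSpace ℝ (Fin N) → ℝ, Measurable f → (∀ x, 0 ≤ f x) →
      MacroBounds N f M₁ M₀ E₀ H₀ →
      ∫⁻ x, ENNReal.ofReal (f x * Real.log (f x)) ≤ ENNReal.ofReal K := by
  set Γ := ∫⁻ x : EuclideanSpace ℝ (Fin N), ENNReal.ofReal (Real.exp (-‖x‖ ^ 2)) with hΓ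
  have hfin : ENNReal.ofReal E₀ + Γ + ENNReal.ofReal H₀ ≠ ∞ := by
    simp [(lintegral_exp_neg_sq_norm_lt_top N).ne, hΓ]
  refine ⟨(ENNReal.ofReal E₀ + Γ + ENNReal.ofReal H₀).toReal, ?_⟩
  rintro f hf hf0 ⟨-, -, hE, hH⟩
  rw [ENNReal.ofReal_toReal hfin]
  refine (le_self_add.trans hH).trans ?_
  gcongr
  calc ∫⁻ x, ENNReal.ofReal (-(f x * Real.log (f x)))
      ≤ ∫⁻ x, (ENNReal.ofReal (‖x‖ ^ 2 * f x) + ENNReal.ofReal (Real.exp (-‖x‖ ^ 2))) := by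
        refine lintegral_mono fun x => ?_
        rw [← ENNReal.ofReal_add (mul_nonneg (sq_nonneg _) (hf0 x)) (Real.exp_nonneg _)]
        exact ENNReal.ofReal_le_ofReal (Real.neg_mul_log_le (hf0 x) _)
    _ = (∫⁻ x, ENNReal.ofReal (‖x‖ ^ 2 * f x)) + Γ := by
        rw [lintegral_add_left (by fun_prop)]
    _ ≤ _ := by gcongr

/-- A fixed part of the mass lies in a ball, where `f` is bounded, and away from any given point. -/
lemma exists_truncated_mass (N : ℕ) (hN : 0 < N) (M₁ M₀ E₀ H₀ : ℝ) (hM₁ : 0 < M₁) (hE₀ : 0 < E₀) :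
    ∃ R₀ L r₀ : ℝ, 0 < R₀ ∧ 0 < L ∧ 0 < r₀ ∧ r₀ ≤ 1 ∧
      ∀ (f : EuclideanSpace ℝ (Fin N) → ℝ) (v : EuclideanSpace ℝ (Fin N)),
        Measurable f → (∀ x, 0 ≤ f x) → MacroBounds N f M₁ M₀ E₀ H₀ →
        ENNReal.ofReal (M₁ / 2) ≤
          ∫⁻ x in {x | ‖x‖ ≤ R₀ ∧ f x ≤ L ∧ r₀ ≤ ‖x - v‖}, ENNReal.ofReal (f x) := by
  obtain ⟨K, hK⟩ := exists_lintegral_mul_log_le N M₁ M₀ E₀ H₀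
  set ℓ := 6 * |K| / M₁ + 1 with hℓ
  have hℓ0 : 0 < ℓ := by positivity
  set L := Real.exp ℓ
  have hL0 : 0 < L := Real.exp_pos _
  set R₀ := Real.sqrt (6 * E₀ / M₁) with hR
  have hR0 : 0 < R₀ := Real.sqrt_pos.2 (by positivity)
  set b := (volume (ball (0 : EuclideanSpace ℝ (Fin N)) 1)).toReal with hb
  have hb0 : 0 ≤ b := ENNReal.toReal_nonneg
  set r₀ := min 1 (M₁ / (6 * L * (b + 1)))
  have hr0 : 0 < r₀ := lt_min one_pos (by positivity)
  have hr1 : r₀ ≤ 1 := min_le_left _ _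
  refine ⟨R₀, L, r₀, hR0, hL0, hr0, hr1, fun f v hf hf0 hB => ?_⟩
  have hlog := hK f hf hf0 hB
  obtain ⟨hmass, -, hE, -⟩ := hB
  set S := {x | ‖x‖ ≤ R₀ ∧ f x ≤ L ∧ r₀ ≤ ‖x - v‖} with hS
  have b1 : ∫⁻ x in {x | R₀ < ‖x‖}, ENNReal.ofReal (f x) ≤ ENNReal.ofReal (M₁ / 6) := by
    have := setLIntegral_ofReal_le_div (T := {x : EuclideanSpace ℝ (Fin N) | R₀ < ‖x‖})
      (measurableSet_lt measurable_const measurable_norm) (pow_pos hR0 2) hf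
      (fun x (hx : R₀ < ‖x‖) => mul_le_mul_of_nonneg_right
        (pow_le_pow_left₀ hR0.le hx.le 2) (hf0 x)) hE
    rwa [hR, Real.sq_sqrt (by positivity),
      show E₀ / (6 * E₀ / M₁) = M₁ / 6 by field_simp] at this
  have b2 : ∫⁻ x in {x | L < f x}, ENNReal.ofReal (f x) ≤ ENNReal.ofReal (M₁ / 6) := by
    refine (setLIntegral_ofReal_le_div (measurableSet_lt measurable_const hf) hℓ0 hf
      (g := fun x => f x * Real.log (f x)) (fun x (hx : L < f x) => ?_) hlog).trans ?_
    · rw [mul_comm]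
      refine mul_le_mul_of_nonneg_left ?_ (hf0 x)
      rw [Real.le_log_iff_exp_le (hL0.trans hx)]
      exact hx.le
    · refine ENNReal.ofReal_le_ofReal ?_
      rw [div_le_iff₀ hℓ0, hℓ, mul_add, show M₁ / 6 * (6 * |K| / M₁) = |K| by field_simp]
      have := le_abs_self K
      linarith
  have b3 : ∫⁻ x in {x | f x ≤ L} ∩ ball v r₀, ENNReal.ofReal (f x) ≤ ENNReal.ofReal (M₁ / 6) := by
    calc ∫⁻ x in {x | f x ≤ L} ∩ ball v r₀, ENNReal.ofReal (f x)
        ≤ ∫⁻ x in {x | f x ≤ L} ∩ ball v r₀, ENNReal.ofReal L :=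
          setLIntegral_mono' ((measurableSet_le hf measurable_const).inter measurableSet_ball)
            fun x hx => ENNReal.ofReal_le_ofReal hx.1
      _ ≤ ENNReal.ofReal L * volume (ball v r₀) := by
          rw [setLIntegral_const]
          gcongr
          exact inter_subset_right
      _ = ENNReal.ofReal (L * (r₀ ^ N * b)) := by
          rw [Measure.addHaar_ball_of_pos _ _ hr0, ENNReal.ofReal_mul hL0.le,
            ENNReal.ofReal_mul (by positivity), hb, ENNReal.ofReal_toReal measure_ball_lt_top.ne]
          simp
      _ ≤ ENNReal.ofReal (M₁ / 6) := by
          refine ENNReal.ofReal_le_ofReal ?_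
          have h1 : r₀ ^ N ≤ r₀ := pow_le_of_le_one hr0.le hr1 hN.ne'
          have h2 : r₀ * (6 * L * (b + 1)) ≤ M₁ :=
            (le_div_iff₀ (by positivity)).1 (min_le_right _ _)
          have h3 : L * (r₀ ^ N * b) ≤ L * (r₀ * (b + 1)) := by
            gcongr
            linarith
          linarith
  have hcov : (univ : Set (EuclideanSpace ℝ (Fin N))) ⊆
      ((S ∪ {x | R₀ < ‖x‖}) ∪ {x | L < f x}) ∪ ({x | f x ≤ L} ∩ ball v r₀) := by
    intro x _
    simp only [hS, mem_union, mem_inter_iff, mem_ofPred_eq, mem_ball, dist_eq_norm]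
    rcases le_or_gt ‖x‖ R₀ with h1 | h1 <;> rcases le_or_gt (f x) L with h2 | h2 <;>
      rcases le_or_gt r₀ ‖x - v‖ with h3 | h3 <;> tauto
  have htot : ENNReal.ofReal M₁ ≤ (∫⁻ x in S, ENNReal.ofReal (f x)) +
      ENNReal.ofReal (M₁ / 6) + ENNReal.ofReal (M₁ / 6) + ENNReal.ofReal (M₁ / 6) := by
    calc ENNReal.ofReal M₁ ≤ ∫⁻ x in univ, ENNReal.ofReal (f x) := by simpa using hmass
      _ ≤ _ := lintegral_mono_set hcov
      _ ≤ _ := (lintegral_union_le _ _ _).trans <| add_le_add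
          ((lintegral_union_le _ _ _).trans <| add_le_add
            ((lintegral_union_le _ _ _).trans <| add_le_add le_rfl b1) b2) b3
  rw [add_assoc, add_assoc, ← ENNReal.ofReal_add (by positivity) (by positivity),
    ← ENNReal.ofReal_add (by positivity) (by positivity), ← tsub_le_iff_right,
    ← ENNReal.ofReal_sub _ (by positivity)] at htot
  convert htot using 2
  ring

lemma graphPoint_self_abs_le {j : Fin (n + 1)} {w : EuclideanSpace ℝ (Fin (n + 1))} (hj : w j ≠ 0)
    (hw : ∀ k, |w k| ≤ |w j|) {ρ : ℝ} {y : Fin n → ℝ} (hy : ∀ k, |y k| ≤ ρ) :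
    |graphPoint j w y j| ≤ n * ρ := by
  rw [graphPoint, insertCoord_same, abs_div, abs_neg, div_le_iff₀ (abs_pos.2 hj)]
  calc |∑ k, y k * w (j.succAbove k)| ≤ ∑ k, |y k * w (j.succAbove k)| :=
        Finset.abs_sum_le_sum_abs _ _
    _ ≤ ∑ _k : Fin n, ρ * |w j| := by
        refine Finset.sum_le_sum fun k _ => ?_
        rw [abs_mul]
        exact mul_le_mul (hy k) (hw _) (abs_nonneg _) ((abs_nonneg _).trans (hy k))
    _ = n * ρ * |w j| := by simp [mul_assoc]

lemma norm_graphPoint_lt {j : Fin (n + 1)} {w : EuclideanSpace ℝ (Fin (n + 1))} (hj : w j ≠ 0)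
    (hw : ∀ k, |w k| ≤ |w j|) {R : ℝ} (hR : 0 < R) {y : Fin n → ℝ}
    (hy : ∀ k, |y k| ≤ R / (2 * ((n : ℝ) + 1) ^ 2)) : ‖graphPoint j w y‖ < R := by
  have hjj := graphPoint_self_abs_le hj hw hy
  set q : ℝ := (n : ℝ) + 1 with hq
  have hq1 : 1 ≤ q := by simp [hq]
  set ρ := R / (2 * q ^ 2) with hρ
  have hρ0 : 0 < ρ := by positivity
  have hRρ : R = 2 * q ^ 2 * ρ := by rw [hρ]; field_simp
  refine lt_of_pow_lt_pow_left₀ 2 hR.le ?_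
  rw [EuclideanSpace.norm_sq_eq]
  have hk : ∀ k, ‖graphPoint j w y k‖ ^ 2 ≤ (q * ρ) ^ 2 := by
    intro k
    refine pow_le_pow_left₀ (norm_nonneg _) ?_ 2
    rw [Real.norm_eq_abs]
    rcases Fin.eq_self_or_eq_succAbove j k with rfl | ⟨a, rfl⟩
    · refine hjj.trans ?_
      gcongr
      simp [hq]
    · rw [graphPoint, insertCoord_succAbove]
      exact (hy a).trans (le_mul_of_one_le_left hρ0.le hq1)
  calc ∑ k, ‖graphPoint j w y k‖ ^ 2 ≤ ∑ _k : Fin (n + 1), (q * ρ) ^ 2 :=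
        Finset.sum_le_sum fun k _ => hk k
    _ = q * (q * ρ) ^ 2 := by simp [hq]
    _ < R ^ 2 := by
        rw [hRρ]
        have h1 : q ^ 3 * ρ ^ 2 ≤ q ^ 4 * ρ ^ 2 := by
          gcongr
          norm_num
        have h2 : 0 < q ^ 4 * ρ ^ 2 := by positivity
        nlinarith

lemma le_lintegral_graphPoint_weight {i j : Fin (n + 1)} (l : Fin n) (hi : j.succAbove l = i)
    {w : EuclideanSpace ℝ (Fin (n + 1))} (hj : w j ≠ 0) (hw : ∀ k, |w k| ≤ |w j|) {R : ℝ}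
    (hR : 0 < R) :
    ENNReal.ofReal ((R / (4 * ((n : ℝ) + 1) ^ 2)) ^ (n + 1) / ‖w‖) ≤
      ∫⁻ y, ENNReal.ofReal (|y l| / |w j|) *
        indicator {h : EuclideanSpace ℝ (Fin (n + 1)) | ‖h‖ < R ∧ h i ≠ 0} 1
          (graphPoint j w y) := by
  set ρ := R / (2 * ((n : ℝ) + 1) ^ 2) with hρ
  have hρ0 : 0 < ρ := by positivity
  have hρ2 : R / (4 * ((n : ℝ) + 1) ^ 2) = ρ / 2 := by rw [hρ]; field_simp; norm_num
  have hw0 : 0 < ‖w‖ := (abs_pos.2 hj).trans_le (PiLp.norm_apply_le w j)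
  set Q : Set (Fin n → ℝ) := Icc (fun _ => ρ / 2) (fun _ => ρ) with hQ
  have hvol : volume Q = ENNReal.ofReal ((ρ / 2) ^ n) := by
    rw [hQ, Real.volume_Icc_pi, Finset.prod_const, Finset.card_univ, Fintype.card_fin,
      ENNReal.ofReal_pow (by positivity), sub_half]
  calc ENNReal.ofReal ((R / (4 * ((n : ℝ) + 1) ^ 2)) ^ (n + 1) / ‖w‖)
      = ∫⁻ _ in Q, ENNReal.ofReal (ρ / 2 / ‖w‖) := by
        rw [setLIntegral_const, hvol, ← ENNReal.ofReal_mul (by positivity), hρ2]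
        congr 1
        ring
    _ ≤ ∫⁻ y in Q, ENNReal.ofReal (|y l| / |w j|) *
        indicator {h : EuclideanSpace ℝ (Fin (n + 1)) | ‖h‖ < R ∧ h i ≠ 0} 1
          (graphPoint j w y) := by
        refine setLIntegral_mono' measurableSet_Icc fun y hy => ?_
        have hlow : ∀ k, ρ / 2 ≤ y k := fun k => hy.1 k
        have hpos : ∀ k, 0 < y k := fun k => (half_pos hρ0).trans_le (hlow k)
        have hmem : graphPoint j w y ∈
            {h : EuclideanSpace ℝ (Fin (n + 1)) | ‖h‖ < R ∧ h i ≠ 0} := by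
          refine ⟨norm_graphPoint_lt hj hw hR fun k => ?_, ?_⟩
          · rw [abs_of_pos (hpos k)]
            exact hy.2 k
          · rw [← hi, graphPoint, insertCoord_succAbove]
            exact (hpos l).ne'
        rw [indicator_of_mem hmem, Pi.one_apply, mul_one]
        refine ENNReal.ofReal_le_ofReal ?_
        exact div_le_div₀ (abs_nonneg _) ((hlow l).trans (le_abs_self _)) (abs_pos.2 hj)
          (PiLp.norm_apply_le w j)
    _ ≤ _ := setLIntegral_le_lintegral _ _

lemma lintegral_graphPoint_le (i : Fin (n + 1)) (h v : EuclideanSpace ℝ (Fin (n + 1)))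
    {φ : EuclideanSpace ℝ (Fin (n + 1)) → ℝ≥0∞} {D : ℝ≥0∞} {R₀ : ℝ} (hR₀ : 0 ≤ R₀)
    (hD : ∀ w, φ w ≤ D) (hs : ∀ w, φ w ≠ 0 → ‖v + w‖ ≤ R₀) :
    ∫⁻ x, φ (graphPoint i h x) ≤ D * ENNReal.ofReal ((2 * R₀) ^ n) := by
  set Q : Set (Fin n → ℝ) := closedBall (fun k => -v (i.succAbove k)) R₀ with hQ
  have hvol : volume Q = ENNReal.ofReal ((2 * R₀) ^ n) := by
    rw [hQ, Real.volume_pi_closedBall _ hR₀, Fintype.card_fin]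
  rw [← hvol, ← setLIntegral_const, ← lintegral_indicator measurableSet_closedBall]
  refine lintegral_mono fun x => ?_
  by_cases hx : φ (graphPoint i h x) = 0
  · simp [hx]
  have hxQ : x ∈ Q := by
    rw [hQ, mem_closedBall, dist_pi_le_iff hR₀]
    intro k
    have h1 := (PiLp.norm_apply_le (v + graphPoint i h x) (i.succAbove k)).trans (hs _ hx)
    rw [PiLp.add_apply, graphPoint, insertCoord_succAbove] at h1
    rwa [dist_eq_norm, sub_neg_eq_add, add_comm]
  rw [indicator_of_mem hxQ]
  exact hD _

/-- Lower bound of the dissipation by its part coming from a kernel with truncated density. -/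
lemma truncated_dissipation_le (γ ν : ℝ) (hν : 0 < ν) (f : EuclideanSpace ℝ (Fin (n + 1)) → ℝ)
    (v : EuclideanSpace ℝ (Fin (n + 1))) (m R : ℝ) (i : Fin (n + 1))
    {φ : EuclideanSpace ℝ (Fin (n + 1)) → ℝ≥0∞} (hφ : Measurable φ)
    (hφf : ∀ w, φ w ≤ ENNReal.ofReal (f (v + w) * ‖w‖ ^ (γ + ν + 1))) :
    ENNReal.ofReal (R ^ (-((n + 1 : ℕ) : ℝ) - ν)) *
      ∫⁻ h in {h : EuclideanSpace ℝ (Fin (n + 1)) | ‖h‖ < R ∧ h i ≠ 0},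
        ENNReal.ofReal (m - f (v + h)) * ∫⁻ x, φ (graphPoint i h x) ≤
      ∫⁻ v', ENNReal.ofReal (m - f v') * Kbar (n + 1) γ ν f v v' := by
  rw [← lintegral_add_left_eq_self
    (fun v' => ENNReal.ofReal (m - f v') * Kbar (n + 1) γ ν f v v') v, ← lintegral_const_mul' _ _ ENNReal.ofReal_ne_top]
  have hB : MeasurableSet {h : EuclideanSpace ℝ (Fin (n + 1)) | ‖h‖ < R ∧ h i ≠ 0} :=
    (measurableSet_lt measurable_norm measurable_const).inter
      ((measurableSet_eq_fun (by fun_prop) measurable_const).compl)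
  refine (setLIntegral_mono' hB fun h hh => ?_).trans (setLIntegral_le_lintegral _ _)
  have hh0 : 0 < ‖h‖ := (abs_pos.2 hh.2).trans_le (PiLp.norm_apply_le h i)
  have hcast : (0 : ℝ) ≤ ((n + 1 : ℕ) : ℝ) := Nat.cast_nonneg _
  rw [Kbar, add_sub_cancel_left, mul_left_comm]
  refine mul_le_mul_right (mul_le_mul' ?_ ?_) _
  · exact ENNReal.ofReal_le_ofReal
      (Real.rpow_le_rpow_of_nonpos hh0 hh.1.le (by linarith))
  · exact (lintegral_graphPoint_le_hyperplane hh.2 hφ).trans (lintegral_mono hφf)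

lemma Real.rpow_bounds_of_mem_Icc {a b x V : ℝ} (ha : 0 < a) (hV : 0 < V) (hax : a * V ≤ x)
    (hxb : x ≤ b * V) (p : ℝ) :
    min (a ^ p) (b ^ p) * V ^ p ≤ x ^ p ∧ x ^ p ≤ (a ^ p + b ^ p) * V ^ p := by
  have hx : 0 < x := (mul_pos ha hV).trans_le hax
  have hb : 0 < b := pos_of_mul_pos_left (hx.trans_le hxb) hV.le
  have ha' := Real.rpow_pos_of_pos ha p
  have hb' := Real.rpow_pos_of_pos hb p
  have hV' := Real.rpow_pos_of_pos hV p
  rcases le_total 0 p with hp | hp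
  · have h1 := Real.rpow_le_rpow (mul_pos ha hV).le hax hp
    have h2 := Real.rpow_le_rpow hx.le hxb hp
    rw [Real.mul_rpow ha.le hV.le] at h1
    rw [Real.mul_rpow hb.le hV.le] at h2
    exact ⟨(mul_le_mul_of_nonneg_right (min_le_left _ _) hV'.le).trans h1,
      h2.trans (mul_le_mul_of_nonneg_right (by linarith) hV'.le)⟩
  · have h1 := Real.rpow_le_rpow_of_nonpos (mul_pos ha hV) hax hp
    have h2 := Real.rpow_le_rpow_of_nonpos hx hxb hp
    rw [Real.mul_rpow ha.le hV.le] at h1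
    rw [Real.mul_rpow hb.le hV.le] at h2
    exact ⟨(mul_le_mul_of_nonneg_right (min_le_right _ _) hV'.le).trans h2,
      h1.trans (mul_le_mul_of_nonneg_right (by linarith) hV'.le)⟩

lemma norm_bounds_of_add_mem {E : Type*} [NormedAddCommGroup E] {v w : E} {R₀ r₀ : ℝ}
    (hR₀ : 0 < R₀) (hr₀ : 0 < r₀) (hr₁ : r₀ ≤ 1) (hvw : ‖v + w‖ ≤ R₀) (hw : r₀ ≤ ‖w‖) :
    r₀ / (2 * (1 + R₀)) * (1 + ‖v‖) ≤ ‖w‖ ∧ ‖w‖ ≤ (1 + R₀) * (1 + ‖v‖) := by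
  have h1 : ‖w‖ ≤ ‖v + w‖ + ‖v‖ := by
    simpa using norm_sub_le (v + w) v
  have h2 : ‖v‖ ≤ ‖v + w‖ + ‖w‖ := by
    simpa using norm_sub_le (v + w) w
  have hv := norm_nonneg v
  constructor
  · rw [div_mul_eq_mul_div, div_le_iff₀ (by positivity)]
    nlinarith
  · nlinarith

/-- Improved mass bound in a region of increments almost orthogonal to `v`. -/
lemma setLIntegral_almost_orthogonal_le (N : ℕ) {M₁ M₀ E₀ H₀ : ℝ} (hM₀ : 0 ≤ M₀) (hE₀ : 0 ≤ E₀)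
    (R₀ : ℝ) {f : EuclideanSpace ℝ (Fin N) → ℝ} (hf : Measurable f) (hf0 : ∀ x, 0 ≤ f x)
    (hB : MacroBounds N f M₁ M₀ E₀ H₀) (v : EuclideanSpace ℝ (Fin N)) :
    ∫⁻ h in {h | |⟪v, h⟫| ≤ R₀ * ‖h‖}, ENNReal.ofReal (f (v + h)) ≤
      ENNReal.ofReal (2 * ((1 + R₀ ^ 2) * M₀ + E₀) / (1 + ‖v‖) ^ 2) := by
  obtain ⟨-, hmass, hE, -⟩ := hB
  refine setLIntegral_ofReal_le_div
    (g := fun h => 2 * ((1 + R₀ ^ 2) * f (v + h) + ‖v + h‖ ^ 2 * f (v + h)))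
    (measurableSet_le (by fun_prop) (by fun_prop)) (by positivity)
    (hf.comp (measurable_const_add v)) (fun h hh => ?_) ?_
  · have h1 : (1 + ‖v‖) ^ 2 ≤ 2 * (1 + R₀ ^ 2 + ‖v + h‖ ^ 2) := by
      have h2 := norm_add_sq_real v h
      have h3 := (abs_le.1 (show |⟪v, h⟫| ≤ R₀ * ‖h‖ from hh)).1
      nlinarith [sq_nonneg (R₀ - ‖h‖), sq_nonneg (1 - ‖v‖)]
    calc (1 + ‖v‖) ^ 2 * f (v + h) ≤ 2 * (1 + R₀ ^ 2 + ‖v + h‖ ^ 2) * f (v + h) :=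
          mul_le_mul_of_nonneg_right h1 (hf0 _)
      _ = _ := by ring
  · rw [lintegral_add_left_eq_self
      (fun x => ENNReal.ofReal (2 * ((1 + R₀ ^ 2) * f x + ‖x‖ ^ 2 * f x))) v]
    have h0 : ∀ x, ENNReal.ofReal (2 * ((1 + R₀ ^ 2) * f x + ‖x‖ ^ 2 * f x)) =
        ENNReal.ofReal 2 * (ENNReal.ofReal (1 + R₀ ^ 2) * ENNReal.ofReal (f x) +
          ENNReal.ofReal (‖x‖ ^ 2 * f x)) := by
      intro x
      have := hf0 x
      rw [ENNReal.ofReal_mul (by norm_num), ENNReal.ofReal_add (by positivity) (by positivity),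
        ENNReal.ofReal_mul (by positivity)]
    simp_rw [h0]
    rw [lintegral_const_mul _ (by fun_prop), lintegral_add_left (by fun_prop),
      lintegral_const_mul _ (by fun_prop), ENNReal.ofReal_mul (by norm_num),
      ENNReal.ofReal_add (by positivity) hE₀, ENNReal.ofReal_mul (by positivity)]
    gcongr

/-- Some cone on which a fixed coordinate is dominant carries its share of an integral. -/
lemma exists_dominant_coordinate {S : Set (EuclideanSpace ℝ (Fin (n + 1)))}
    {g : EuclideanSpace ℝ (Fin (n + 1)) → ℝ≥0∞} {M : ℝ} (hM : ENNReal.ofReal M ≤ ∫⁻ w in S, g w) :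
    ∃ j, ENNReal.ofReal (M / ((n : ℝ) + 1)) ≤ ∫⁻ w in S ∩ {w | ∀ k, |w k| ≤ |w j|}, g w := by
  have hcov : S ⊆ ⋃ j, S ∩ {w : EuclideanSpace ℝ (Fin (n + 1)) | ∀ k, |w k| ≤ |w j|} := by
    intro w hw
    obtain ⟨j, -, hj⟩ := Finset.exists_max_image Finset.univ (fun k => |w k|) ⟨0, by simp⟩
    exact mem_iUnion.2 ⟨j, hw, fun k => hj k (Finset.mem_univ k)⟩
  have h1 := hM.trans ((lintegral_mono_set hcov).trans (lintegral_iUnion_le _ _))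
  rw [tsum_fintype] at h1
  have h2 : ∑ _j : Fin (n + 1), ENNReal.ofReal (M / ((n : ℝ) + 1)) = ENNReal.ofReal M := by
    rw [Finset.sum_const, Finset.card_univ, Fintype.card_fin, ← ENNReal.ofReal_nsmul, nsmul_eq_mul]
    congr 1
    push_cast
    field_simp
  rw [← h2] at h1
  by_contra! hlt
  exact h1.not_gt (ENNReal.sum_lt_sum_of_nonempty ⟨0, Finset.mem_univ 0⟩ fun j _ => hlt j)

/-- Dissipation bound with a free radius `R`. -/
lemma dissipation_ge_of_radius (hn : 1 ≤ n) (γ ν M₁ M₀ E₀ H₀ : ℝ) (hν : 0 < ν)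
    (hM₁ : 0 < M₁) (hM : M₁ ≤ M₀) (hE₀ : 0 < E₀) :
    ∃ a b : ℝ, 0 < a ∧ 0 < b ∧
      ∀ (f : EuclideanSpace ℝ (Fin (n + 1)) → ℝ) (v : EuclideanSpace ℝ (Fin (n + 1))) (m R : ℝ),
        Measurable f → (∀ x, 0 ≤ f x) → MacroBounds (n + 1) f M₁ M₀ E₀ H₀ →
        0 < m → 0 < R → (∀ v', f v' ≤ m) →
        ENNReal.ofReal (R ^ (-((n + 1 : ℕ) : ℝ) - ν) *
            (m * (a * R ^ (n + 1) * (1 + ‖v‖) ^ (γ + ν)) - b * (1 + ‖v‖) ^ (γ + ν - 1))) ≤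
          ∫⁻ v', ENNReal.ofReal (m - f v') * Kbar (n + 1) γ ν f v v' := by
  obtain ⟨R₀, L, r₀, hR₀, hL, hr₀, hr₁, htrunc⟩ :=
    exists_truncated_mass (n + 1) n.succ_pos M₁ M₀ E₀ H₀ hM₁ hE₀
  have hM₀ : 0 < M₀ := hM₁.trans_le hM
  set p := γ + ν + 1 with hp
  set a₁ := r₀ / (2 * (1 + R₀))
  set b₁ := 1 + R₀
  have ha₁0 : 0 < a₁ := by positivity
  have hb₁0 : 0 < b₁ := by positivity
  set c₃ := min (a₁ ^ (p - 1)) (b₁ ^ (p - 1))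
  have hc₃0 : 0 < c₃ := lt_min (Real.rpow_pos_of_pos ha₁0 _) (Real.rpow_pos_of_pos hb₁0 _)
  set c₂ := a₁ ^ p + b₁ ^ p
  have hc₂0 : 0 < c₂ := add_pos (Real.rpow_pos_of_pos ha₁0 _) (Real.rpow_pos_of_pos hb₁0 _)
  set c₅ := 2 * ((1 + R₀ ^ 2) * M₀ + E₀)
  have hc₅0 : 0 < c₅ := by positivity
  set c₆ : ℝ := (1 / (4 * ((n : ℝ) + 1) ^ 2)) ^ (n + 1) with hc₆
  have hc₆0 : 0 < c₆ := by positivity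
  refine ⟨c₃ * c₆ * (M₁ / 2 / ((n : ℝ) + 1)), L * c₂ * (2 * R₀) ^ n * c₅, by positivity,
    by positivity, fun f v m R hf hf0 hB hm hR hfm => ?_⟩
  set V := 1 + ‖v‖
  have hV0 : 0 < V := by positivity
  set S : Set (EuclideanSpace ℝ (Fin (n + 1))) := {x | ‖x‖ ≤ R₀ ∧ f x ≤ L ∧ r₀ ≤ ‖x - v‖}
  have mS : MeasurableSet S := (measurableSet_le measurable_norm measurable_const).inter
    ((measurableSet_le hf measurable_const).inter
      (measurableSet_le measurable_const (measurable_id.sub_const v).norm))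
  set S' := (fun w => v + w) ⁻¹' S
  have mS' : MeasurableSet S' := measurable_const_add v mS
  have hmass : ENNReal.ofReal (M₁ / 2) ≤ ∫⁻ w in S', ENNReal.ofReal (f (v + w)) := by
    refine (htrunc f v hf hf0 hB).trans (le_of_eq ?_)
    rw [← lintegral_indicator mS, ← lintegral_indicator mS', ← lintegral_add_left_eq_self _ v]
    rfl
  obtain ⟨j, hj⟩ := exists_dominant_coordinate hmass
  set T := S' ∩ {w | ∀ k, |w k| ≤ |w j|}
  have mT : MeasurableSet T := by
    refine mS'.inter ?_
    rw [ofPred_forall]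
    exact MeasurableSet.iInter fun k => measurableSet_le (by fun_prop) (by fun_prop)
  obtain ⟨i, hij⟩ : ∃ i : Fin (n + 1), i ≠ j := by
    have : Nontrivial (Fin (n + 1)) := Fin.nontrivial_iff_two_le.2 (by omega)
    exact exists_ne j
  obtain ⟨k, hk⟩ := Fin.exists_succAbove_eq hij.symm
  obtain ⟨l, hl⟩ := Fin.exists_succAbove_eq hij
  have hTw : ∀ w ∈ T, ‖v + w‖ ≤ R₀ ∧ f (v + w) ≤ L ∧ 0 < ‖w‖ ∧ a₁ * V ≤ ‖w‖ ∧ ‖w‖ ≤ b₁ * V := by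
    rintro w ⟨⟨h1, h2, h3⟩, -⟩
    rw [add_sub_cancel_left] at h3
    have := norm_bounds_of_add_mem hR₀ hr₀ hr₁ h1 h3
    exact ⟨h1, h2, hr₀.trans_le h3, this.1, this.2⟩
  set φ : EuclideanSpace ℝ (Fin (n + 1)) → ℝ≥0∞ :=
    T.indicator fun w => ENNReal.ofReal (f (v + w) * ‖w‖ ^ p) with hφdef
  have hφ : Measurable φ := by
    refine Measurable.indicator ?_ mT
    fun_prop
  have hφf : ∀ w, φ w ≤ ENNReal.ofReal (f (v + w) * ‖w‖ ^ p) := fun w =>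
    indicator_le_self _ _ w
  have hφD : ∀ w, φ w ≤ ENNReal.ofReal (L * (c₂ * V ^ p)) := by
    intro w
    refine indicator_apply_le' (fun hw => ?_) (fun _ => zero_le)
    obtain ⟨-, h2, -, h4, h5⟩ := hTw w hw
    refine ENNReal.ofReal_le_ofReal ?_
    exact mul_le_mul h2 (Real.rpow_bounds_of_mem_Icc ha₁0 hV0 h4 h5 p).2 (by positivity) hL.le
  have hφs : ∀ w, φ w ≠ 0 → ‖v + w‖ ≤ R₀ := fun w hw =>
    (hTw w (mem_of_indicator_ne_zero hw)).1
  set B := {h : EuclideanSpace ℝ (Fin (n + 1)) | ‖h‖ < R ∧ h i ≠ 0}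
  have mB : MeasurableSet B := (measurableSet_lt measurable_norm measurable_const).inter
    ((measurableSet_eq_fun (by fun_prop) measurable_const).compl)
  set g := fun h => ∫⁻ x, φ (graphPoint i h x) with hg
  have mg : Measurable g := (hφ.comp (measurable_graphPoint i)).lintegral_prod_right'
  have hJ : ENNReal.ofReal (c₃ * c₆ * (M₁ / 2 / ((n : ℝ) + 1)) * R ^ (n + 1) * V ^ (γ + ν)) ≤
      ∫⁻ h in B, g h := by
    calc ENNReal.ofReal (c₃ * c₆ * (M₁ / 2 / ((n : ℝ) + 1)) * R ^ (n + 1) * V ^ (γ + ν))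
        = ENNReal.ofReal (c₃ * V ^ (p - 1) * (c₆ * R ^ (n + 1))) *
            ENNReal.ofReal (M₁ / 2 / ((n : ℝ) + 1)) := by
          rw [← ENNReal.ofReal_mul (by positivity), hp, add_sub_cancel_right]
          congr 1
          ring
      _ ≤ ENNReal.ofReal (c₃ * V ^ (p - 1) * (c₆ * R ^ (n + 1))) *
            ∫⁻ w in T, ENNReal.ofReal (f (v + w)) := by gcongr
      _ = ∫⁻ w, T.indicator (fun w => ENNReal.ofReal (c₃ * V ^ (p - 1) * (c₆ * R ^ (n + 1))) *
            ENNReal.ofReal (f (v + w))) w := by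
          rw [lintegral_indicator mT, lintegral_const_mul _ (by fun_prop)]
      _ ≤ ∫⁻ w, φ w * ∫⁻ y, ENNReal.ofReal (|y l| / |w j|) *
            indicator B 1 (graphPoint j w y) := by
          refine lintegral_mono fun w => indicator_apply_le' (fun hw => ?_) (fun _ => zero_le)
          obtain ⟨-, -, hw0, h4, h5⟩ := hTw w hw
          have hwj : w j ≠ 0 := by
            intro h0
            have : w = 0 := by
              ext k
              have := hw.2 k
              rw [h0, abs_zero] at this
              simpa using this
            simp [this] at hw0
          refine le_trans ?_ (mul_le_mul_right
            (le_lintegral_graphPoint_weight l hl hwj hw.2 hR) _)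
          have hfw := hf0 (v + w)
          rw [hφdef, indicator_of_mem hw, ← ENNReal.ofReal_mul (by positivity),
            ← ENNReal.ofReal_mul (by positivity)]
          refine ENNReal.ofReal_le_ofReal ?_
          have hlow := (Real.rpow_bounds_of_mem_Icc ha₁0 hV0 h4 h5 (p - 1)).1
          have e : f (v + w) * ‖w‖ ^ p * ((R / (4 * ((n : ℝ) + 1) ^ 2)) ^ (n + 1) / ‖w‖) =
              ‖w‖ ^ (p - 1) * (c₆ * R ^ (n + 1)) * f (v + w) := by
            rw [Real.rpow_sub_one hw0.ne', hc₆, ← mul_pow, one_div_mul_eq_div]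
            ring
          rw [e]
          gcongr
      _ ≤ ∫⁻ h, indicator B 1 h * ∫⁻ x, φ (graphPoint i h x) :=
          lintegral_graphPoint_swap_le k l hk hl (measurable_one.indicator mB) hφ
      _ = ∫⁻ h in B, g h := by
          rw [← lintegral_indicator mB]
          refine lintegral_congr fun h => ?_
          by_cases hh : h ∈ B <;> simp [hh, hg]
  have hY : ∫⁻ h in B, ENNReal.ofReal (f (v + h)) * g h ≤
      ENNReal.ofReal (L * c₂ * (2 * R₀) ^ n * c₅ * V ^ (γ + ν - 1)) := by
    have hgD : ∀ h, g h ≤ ENNReal.ofReal (L * (c₂ * V ^ p)) * ENNReal.ofReal ((2 * R₀) ^ n) :=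
      fun h => lintegral_graphPoint_le i h v hR₀.le hφD hφs
    set A := {h : EuclideanSpace ℝ (Fin (n + 1)) | |⟪v, h⟫| ≤ R₀ * ‖h‖}
    have mA : MeasurableSet A := measurableSet_le (by fun_prop) (by fun_prop)
    have hgA : ∀ h ∈ B, h ∉ A → g h = 0 := by
      intro h hhB hhA
      refine (lintegral_congr fun x => ?_).trans lintegral_zero
      by_contra hx
      refine hhA ?_
      have h1 := hφs _ hx
      have h2 : ⟪v, h⟫ = ⟪v + graphPoint i h x, h⟫ := by
        rw [inner_add_left, inner_graphPoint hhB.2, add_zero]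
      change |⟪v, h⟫| ≤ R₀ * ‖h‖
      rw [h2]
      exact (abs_real_inner_le_norm _ _).trans (by gcongr)
    calc ∫⁻ h in B, ENNReal.ofReal (f (v + h)) * g h
        ≤ ∫⁻ h in B, A.indicator (fun h => ENNReal.ofReal (f (v + h)) *
          (ENNReal.ofReal (L * (c₂ * V ^ p)) * ENNReal.ofReal ((2 * R₀) ^ n))) h := by
          refine setLIntegral_mono' mB fun h hh => ?_
          by_cases hhA : h ∈ A
          · rw [indicator_of_mem hhA]
            gcongr
            exact hgD h
          · simp [hgA h hh hhA]
      _ ≤ ∫⁻ h, A.indicator (fun h => ENNReal.ofReal (f (v + h)) *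
          (ENNReal.ofReal (L * (c₂ * V ^ p)) * ENNReal.ofReal ((2 * R₀) ^ n))) h :=
          setLIntegral_le_lintegral _ _
      _ = (∫⁻ h in A, ENNReal.ofReal (f (v + h))) *
          (ENNReal.ofReal (L * (c₂ * V ^ p)) * ENNReal.ofReal ((2 * R₀) ^ n)) := by
          rw [lintegral_indicator mA, lintegral_mul_const _ (by fun_prop)]
      _ ≤ ENNReal.ofReal (c₅ / V ^ 2) *
          (ENNReal.ofReal (L * (c₂ * V ^ p)) * ENNReal.ofReal ((2 * R₀) ^ n)) := by
          gcongr
          exact setLIntegral_almost_orthogonal_le (n + 1) hM₀.le hE₀.le R₀ hf hf0 hB v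
      _ = _ := by
          rw [← ENNReal.ofReal_mul (by positivity), ← ENNReal.ofReal_mul (by positivity)]
          congr 1
          have e : V ^ p = V ^ (γ + ν - 1) * V ^ 2 := by
            rw [← Real.rpow_natCast V 2, ← Real.rpow_add hV0, hp]
            congr 1
            push_cast
            ring
          rw [e]
          field_simp
  refine le_trans ?_ (truncated_dissipation_le γ ν hν f v m R i hφ hφf)
  rw [ENNReal.ofReal_mul (by positivity), ENNReal.ofReal_sub _ (by positivity),
    ENNReal.ofReal_mul hm.le]
  gcongr
  rw [tsub_le_iff_right]
  calc ENNReal.ofReal m * ENNReal.ofReal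
        (c₃ * c₆ * (M₁ / 2 / ((n : ℝ) + 1)) * R ^ (n + 1) * V ^ (γ + ν))
      ≤ ENNReal.ofReal m * ∫⁻ h in B, g h := by gcongr
    _ = ∫⁻ h in B, (ENNReal.ofReal (m - f (v + h)) * g h + ENNReal.ofReal (f (v + h)) * g h) := by
        rw [← lintegral_const_mul _ mg]
        refine lintegral_congr fun h => ?_
        rw [← add_mul, ← ENNReal.ofReal_add (sub_nonneg.2 (hfm _)) (hf0 _), sub_add_cancel]
    _ = (∫⁻ h in B, ENNReal.ofReal (m - f (v + h)) * g h) +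
        ∫⁻ h in B, ENNReal.ofReal (f (v + h)) * g h := by
        have mX : Measurable fun h => ENNReal.ofReal (m - f (v + h)) * g h :=
          Measurable.mul (by fun_prop) mg
        rw [lintegral_add_left mX]
    _ ≤ _ := by gcongr

/-- The radius balancing the two terms of `dissipation_ge_of_radius`. -/
lemma exists_balancing_radius (n : ℕ) (γ ν : ℝ) {a b m V : ℝ} (ha : 0 < a) (hb : 0 < b)
    (hm : 0 < m) (hV : 0 < V) :
    ∃ R : ℝ, 0 < R ∧
      R ^ (-((n + 1 : ℕ) : ℝ) - ν) *
          (m * (a * R ^ (n + 1) * V ^ (γ + ν)) - b * V ^ (γ + ν - 1)) =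
        a / 2 * (2 * b / a) ^ (-(ν / ((n + 1 : ℕ) : ℝ))) * m ^ (1 + ν / ((n + 1 : ℕ) : ℝ)) *
          V ^ (ν * (1 + 1 / ((n + 1 : ℕ) : ℝ)) + γ) := by
  set q : ℝ := ((n + 1 : ℕ) : ℝ) with hq
  have hq0 : 0 < q := by positivity
  set X := 2 * b / a / (m * V) with hX
  have hX0 : 0 < X := by positivity
  refine ⟨X ^ (1 / q), by positivity, ?_⟩
  have hpow : (X ^ (1 / q)) ^ (n + 1) = X := by
    rw [← Real.rpow_natCast, ← Real.rpow_mul hX0.le, ← hq, one_div_mul_cancel hq0.ne',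
      Real.rpow_one]
  have hfac : (X ^ (1 / q)) ^ (-q - ν) = X⁻¹ * X ^ (-(ν / q)) := by
    rw [← Real.rpow_mul hX0.le, ← Real.rpow_neg_one X, ← Real.rpow_add hX0]
    congr 1
    field_simp
    ring
  have hXν : X ^ (-(ν / q)) = (2 * b / a) ^ (-(ν / q)) * (m ^ (ν / q) * V ^ (ν / q)) := by
    rw [hX, Real.div_rpow (by positivity) (by positivity), Real.rpow_neg (mul_pos hm hV).le,
      Real.mul_rpow hm.le hV.le, div_inv_eq_mul]
  have hVe : V ^ (ν * (1 + 1 / q) + γ) = V ^ (γ + ν) * V ^ (ν / q) := by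
    rw [← Real.rpow_add hV]
    congr 1
    ring
  rw [hpow, hfac, hXν, hVe, Real.rpow_add hm, Real.rpow_one, Real.rpow_sub_one hV.ne', hX]
  field_simp
  ring

/-- **Dissipation lower bound at a maximum point** (the key estimate in the proof of the
`L^∞` bound, combining Lemmas 7.1 and 7.2 of the paper with the energy bound). If `f`
satisfies the macroscopic bounds and attains its maximum value `m > 0` at `v`, then
`∫ (m - f(v')) K̄_f(v,v') dv' ≥ c m^{1+ν/N} (1+|v|)^{ν(1+1/N)+γ}`, with `c > 0` depending
only on `N`, `γ`, `ν` and the macroscopic constants. -/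
theorem dissipation_lower_bound_at_max
    (N : ℕ) (hN : 2 ≤ N) (γ ν M₁ M₀ E₀ H₀ : ℝ)
    (hγ : -(N : ℝ) < γ) (hν : ν ∈ Ioo (0:ℝ) 2)
    (hM₁ : 0 < M₁) (hM : M₁ ≤ M₀) (hE₀ : 0 < E₀) :
    ∃ c : ℝ, 0 < c ∧
      ∀ (f : EuclideanSpace ℝ (Fin N) → ℝ) (v : EuclideanSpace ℝ (Fin N)) (m : ℝ),
        Measurable f → (∀ x, 0 ≤ f x) →
        MacroBounds N f M₁ M₀ E₀ H₀ →
        0 < m → f v = m → (∀ v', f v' ≤ m) →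
        ENNReal.ofReal
            (c * m ^ (1 + ν / (N : ℝ)) * (1 + ‖v‖) ^ (ν * (1 + 1 / (N : ℝ)) + γ)) ≤
          ∫⁻ v', ENNReal.ofReal (m - f v') * Kbar N γ ν f v v' := by
  obtain ⟨n, rfl⟩ : ∃ n, N = n + 1 := ⟨N - 1, by omega⟩
  obtain ⟨a, b, ha, hb, hab⟩ :=
    dissipation_ge_of_radius (n := n) (by omega) γ ν M₁ M₀ E₀ H₀ hν.1 hM₁ hM hE₀
  refine ⟨a / 2 * (2 * b / a) ^ (-(ν / ((n + 1 : ℕ) : ℝ))), by positivity,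
    fun f v m hf hf0 hB hm _ hfm => ?_⟩
  obtain ⟨R, hR, hRe⟩ := exists_balancing_radius n γ ν ha hb hm
    (show 0 < 1 + ‖v‖ by positivity)
  rw [← hRe]
  exact hab f v m R hf hf0 hB hm hR hfm
end
end

section
/- Let N ≥ 2 be an integer, γ > −N, ν ∈ (0,2), and let B(r,θ) = r^γ b(cos θ) be a non-cutoff cross section with constant C_b ≥ 1. Fix a unit vector e ∈ S^{N−1}. Then the function σ ↦ (2^{(N+γ)/2} (1 + σ·e)^{−(N+γ)/2} − 1) b(σ·e) is integrable on S^{N−1} with respect to surface measure, and its integral I satisfies 0 < I < ∞ and does not depend on the choice of e. Consequently, for every r > 0, ∫_{S^{N−1}} (2^{N/2} (1+σ·e)^{−N/2} B(√2 r/√(1+σ·e), θ) − B(r,θ)) dσ = I r^γ, where θ ∈ (0,π) is determined by cos θ = σ·e. -/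
open MeasureTheory Metric Set
open scoped ENNReal RealInnerProductSpace

noncomputable section

/-- The integrand `σ ↦ (2^{(N+γ)/2} (1+σ·e)^{-(N+γ)/2} − 1) b(σ·e)` of the cancellation
lemma; it is nonnegative since `1 + σ·e ≤ 2` on the sphere. -/
def cancellationIntegrand (N : ℕ) (γ : ℝ) (b : ℝ → ℝ≥0∞)
    (e σ : EuclideanSpace ℝ (Fin N)) : ℝ≥0∞ :=
  ENNReal.ofReal
      ((2 : ℝ) ^ (((N : ℝ) + γ) / 2) * (1 + ⟪σ, e⟫) ^ (-(((N : ℝ) + γ) / 2)) - 1) *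
    b ⟪σ, e⟫

/-- Comparison of real powers at two scales differing by a factor of at most two. -/
lemma rpow_le_two_rpow_abs_mul {x y : ℝ} (hy : 0 < y) (hxy : y / 2 ≤ x) (hx : x ≤ y) (a : ℝ) :
    x ^ a ≤ 2 ^ |a| * y ^ a := by
  have hx0 : 0 < x := by linarith
  rcases le_total 0 a with ha | ha
  · calc x ^ a ≤ y ^ a := Real.rpow_le_rpow hx0.le hx ha
      _ ≤ 2 ^ |a| * y ^ a :=
        le_mul_of_one_le_left (by positivity) (Real.one_le_rpow one_le_two (abs_nonneg a))
  · calc x ^ a ≤ (y / 2) ^ a := Real.rpow_le_rpow_of_nonpos (by linarith) hxy ha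
      _ = 2 ^ |a| * y ^ a := by
        rw [Real.div_rpow hy.le zero_le_two, abs_of_nonpos ha, Real.rpow_neg zero_le_two]
        ring

/-- If balls of radius `ρ` around `x₀` have measure `O(ρ ^ d)`, then powers of the distance to `x₀`
with exponent larger than `-d` are integrable on punctured balls. -/
lemma setLIntegral_lt_top_of_le_dist_rpow {X : Type*} [PseudoMetricSpace X] [MeasurableSpace X]
    [OpensMeasurableSpace X] {μ : Measure X} {x₀ : X} {R C K d δ : ℝ}
    (hR : 0 < R) (hK : 0 ≤ K) (hδ : 0 < δ)
    (hμ : ∀ ρ ∈ Ioc 0 R, μ (closedBall x₀ ρ) ≤ ENNReal.ofReal (C * ρ ^ d))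
    {s : Set X} (hsm : MeasurableSet s) (hs : ∀ x ∈ s, dist x x₀ ∈ Ioc 0 R)
    {f : X → ℝ≥0∞} (hf : ∀ x ∈ s, f x ≤ ENNReal.ofReal (K * dist x x₀ ^ (δ - d))) :
    ∫⁻ x in s, f x ∂μ < ⊤ := by
  set ρ : ℕ → ℝ := fun k => R * (1 / 2) ^ k with hρ
  have hρ0 : ∀ k, 0 < ρ k := fun k => by positivity
  have hρR : ∀ k, ρ k ≤ R := fun k =>
    mul_le_of_le_one_right hR.le (pow_le_one₀ (by norm_num) (by norm_num))
  set A : ℕ → Set X := fun k => s ∩ {x | ρ k / 2 < dist x x₀ ∧ dist x x₀ ≤ ρ k} with hA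
  have hAm : ∀ k, MeasurableSet (A k) := fun k =>
    hsm.inter ((isOpen_lt continuous_const
      (continuous_id.dist continuous_const)).measurableSet.inter
      (isClosed_closedBall (x := x₀) (ε := ρ k)).measurableSet)
  have hcover : s ⊆ ⋃ k, A k := by
    intro x hx
    obtain ⟨h0, h1⟩ := hs x hx
    obtain ⟨n, hn1, hn2⟩ := exists_nat_pow_near_of_lt_one (div_pos h0 hR)
      ((div_le_one hR).2 h1) (by norm_num : (0:ℝ) < 1 / 2) (by norm_num)
    rw [lt_div_iff₀ hR] at hn1
    rw [div_le_iff₀ hR] at hn2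
    refine mem_iUnion.2 ⟨n, hx, ?_, ?_⟩
    · simp only [hρ]
      rw [pow_succ] at hn1
      linarith
    · simp only [hρ]
      linarith
  have hterm : ∀ k, ∫⁻ x in A k, f x ∂μ ≤
      ENNReal.ofReal (K * 2 ^ |δ - d| * C * R ^ δ * ((1 / 2) ^ δ) ^ k) := by
    intro k
    calc ∫⁻ x in A k, f x ∂μ
        ≤ ∫⁻ _ in A k, ENNReal.ofReal (K * (2 ^ |δ - d| * ρ k ^ (δ - d))) ∂μ := by
          refine setLIntegral_mono' (hAm k) fun x hx => (hf x hx.1).trans ?_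
          exact ENNReal.ofReal_le_ofReal (mul_le_mul_of_nonneg_left
            (rpow_le_two_rpow_abs_mul (hρ0 k) hx.2.1.le hx.2.2 _) hK)
      _ = ENNReal.ofReal (K * (2 ^ |δ - d| * ρ k ^ (δ - d))) * μ (A k) := by
          rw [setLIntegral_const]
      _ ≤ ENNReal.ofReal (K * (2 ^ |δ - d| * ρ k ^ (δ - d))) *
            ENNReal.ofReal (C * ρ k ^ d) := by
          gcongr
          exact (measure_mono fun x hx => hx.2.2).trans (hμ _ ⟨hρ0 k, hρR k⟩)
      _ = ENNReal.ofReal (K * 2 ^ |δ - d| * C * R ^ δ * ((1 / 2) ^ δ) ^ k) := by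
          have h1 := hρ0 k
          rw [← ENNReal.ofReal_mul (by positivity)]
          congr 1
          have h2 : R ^ δ * ((1 / 2) ^ δ) ^ k = ρ k ^ (δ - d) * ρ k ^ d := by
            rw [← Real.rpow_add h1, sub_add_cancel, Real.mul_rpow hR.le (by positivity),
              ← Real.rpow_natCast, ← Real.rpow_natCast, ← Real.rpow_mul (by norm_num),
              ← Real.rpow_mul (by norm_num), mul_comm δ]
          linear_combination (-(K * 2 ^ |δ - d| * C)) * h2
  have hsum : Summable fun k : ℕ =>
      K * 2 ^ |δ - d| * C * R ^ δ * (((1 / 2 : ℝ)) ^ δ) ^ k :=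
    (summable_geometric_of_lt_one (by positivity)
      (Real.rpow_lt_one (by norm_num) (by norm_num) hδ)).mul_left _
  calc ∫⁻ x in s, f x ∂μ ≤ ∫⁻ x in ⋃ k, A k, f x ∂μ := lintegral_mono_set hcover
    _ ≤ ∑' k, ∫⁻ x in A k, f x ∂μ := lintegral_iUnion_le _ _
    _ ≤ _ := ENNReal.tsum_le_tsum hterm
    _ < ⊤ := hsum.tsum_ofReal_lt_top

section Sphere

variable {E : Type*} [NormedAddCommGroup E] [InnerProductSpace ℝ E]

lemma inner_stereoInvFun {v : E} (hv : ‖v‖ = 1) (u w : (ℝ ∙ v)ᗮ) :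
    ⟪(stereoInvFun hv u : E), (stereoInvFun hv w : E)⟫ =
      (16 * ⟪u, w⟫ + (‖u‖ ^ 2 - 4) * (‖w‖ ^ 2 - 4)) / ((‖u‖ ^ 2 + 4) * (‖w‖ ^ 2 + 4)) := by
  have hu : ⟪(u : E), v⟫ = 0 := Submodule.mem_orthogonal_singleton_iff_inner_left.1 u.2
  have hw : ⟪v, (w : E)⟫ = 0 := Submodule.mem_orthogonal_singleton_iff_inner_right.1 w.2
  have hvv : ⟪v, v⟫ = 1 := by rw [real_inner_self_eq_norm_sq, hv, one_pow]
  simp only [stereoInvFun_apply, inner_smul_left, inner_smul_right, inner_add_left,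
    inner_add_right, hu, hw, hvv, Submodule.coe_inner, RCLike.conj_to_real]
  field_simp
  ring

lemma inner_stereoInvFun_pole {v : E} (hv : ‖v‖ = 1) (u : (ℝ ∙ v)ᗮ) :
    ⟪(stereoInvFun hv u : E), v⟫ = (‖u‖ ^ 2 - 4) / (‖u‖ ^ 2 + 4) := by
  have hu : ⟪(u : E), v⟫ = 0 := Submodule.mem_orthogonal_singleton_iff_inner_left.1 u.2
  have hvv : ⟪v, v⟫ = 1 := by rw [real_inner_self_eq_norm_sq, hv, one_pow]
  simp only [stereoInvFun_apply, inner_smul_left, inner_add_left, hu, hvv, RCLike.conj_to_real]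
  field_simp
  ring

lemma dist_sq_eq_two_sub_inner {x y : E} (hx : ‖x‖ = 1) (hy : ‖y‖ = 1) :
    dist x y ^ 2 = 2 - 2 * ⟪x, y⟫ := by
  rw [dist_eq_norm, norm_sub_sq_real, hx, hy]
  ring

/-- Inverse stereographic projection does not increase distances. -/
lemma lipschitzWith_stereoInvFun {v : E} (hv : ‖v‖ = 1) :
    LipschitzWith 1 fun u : (ℝ ∙ v)ᗮ => (stereoInvFun hv u : E) := by
  refine LipschitzWith.of_dist_le_mul fun u w => ?_
  rw [NNReal.coe_one, one_mul]
  refine le_of_sq_le_sq ?_ dist_nonneg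
  rw [dist_sq_eq_two_sub_inner (by simpa using (stereoInvFun hv u).2)
    (by simpa using (stereoInvFun hv w).2), inner_stereoInvFun, dist_eq_norm, norm_sub_sq_real]
  have h1 : 2 - 2 * ((16 * ⟪u, w⟫ + (‖u‖ ^ 2 - 4) * (‖w‖ ^ 2 - 4)) /
      ((‖u‖ ^ 2 + 4) * (‖w‖ ^ 2 + 4))) =
      16 * (‖u‖ ^ 2 - 2 * ⟪u, w⟫ + ‖w‖ ^ 2) / ((‖u‖ ^ 2 + 4) * (‖w‖ ^ 2 + 4)) := by
    field_simp
    ring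
  have h2 : 0 ≤ ‖u‖ ^ 2 - 2 * ⟪u, w⟫ + ‖w‖ ^ 2 := by
    rw [← norm_sub_sq_real]; positivity
  rw [h1, div_le_iff₀ (by positivity), mul_comm]
  refine mul_le_mul_of_nonneg_left ?_ h2
  nlinarith [sq_nonneg ‖u‖, sq_nonneg ‖w‖, mul_nonneg (sq_nonneg ‖u‖) (sq_nonneg ‖w‖)]

/-- A spherical cap contained in a hemisphere is the stereographic image of a ball. -/
lemma sphere_inter_closedBall_subset_image_stereoInvFun {v : E} (hv : ‖v‖ = 1) {ρ : ℝ}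
    (hρ : ρ ∈ Ioc 0 √2) :
    sphere (0 : E) 1 ∩ closedBall (-v) ρ ⊆
      (fun u : (ℝ ∙ v)ᗮ => (stereoInvFun hv u : E)) '' closedBall 0 (2 * ρ) := by
  rintro x ⟨hx, hxρ⟩
  have hx1 : ‖x‖ = 1 := by simpa using hx
  have hρ2 : ρ ^ 2 ≤ 2 := by
    have := Real.sq_sqrt (zero_le_two (α := ℝ))
    nlinarith [hρ.1, hρ.2]
  have hd : 2 + 2 * ⟪x, v⟫ ≤ ρ ^ 2 := by
    have h := dist_sq_eq_two_sub_inner hx1 (show ‖-v‖ = 1 by rw [norm_neg, hv])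
    rw [inner_neg_right] at h
    have h' : dist x (-v) ^ 2 ≤ ρ ^ 2 := pow_le_pow_left₀ dist_nonneg hxρ 2
    linarith
  have hxv : x ≠ v := by
    rintro rfl
    rw [real_inner_self_eq_norm_sq, hv] at hd
    linarith
  have hinv := stereo_left_inv hv (x := ⟨x, hx⟩) hxv
  set u := stereoToFun v x with hu
  have hinv' : (stereoInvFun hv u : E) = x := congrArg Subtype.val hinv
  refine ⟨u, ?_, hinv'⟩
  have hi := inner_stereoInvFun_pole hv u
  rw [hinv'] at hi
  rw [hi] at hd
  have h2 : 2 + 2 * ((‖u‖ ^ 2 - 4) / (‖u‖ ^ 2 + 4)) = 4 * ‖u‖ ^ 2 / (‖u‖ ^ 2 + 4) := by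
    field_simp
    ring
  rw [h2, div_le_iff₀ (by positivity)] at hd
  rw [mem_closedBall_zero_iff]
  refine le_of_sq_le_sq ?_ (by linarith [hρ.1])
  nlinarith [mul_le_mul_of_nonneg_right hρ2 (sq_nonneg ‖u‖)]

variable {m : ℕ}

lemma finrank_orthogonal_singleton_of_norm_eq_one (hE : Module.finrank ℝ E = m + 1) {v : E}
    (hv : ‖v‖ = 1) : Module.finrank ℝ (ℝ ∙ v)ᗮ = m :=
  haveI : Fact (Module.finrank ℝ E = m + 1) := ⟨hE⟩
  Submodule.finrank_orthogonal_span_singleton (by rintro rfl; simp at hv)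

variable [MeasurableSpace E] [BorelSpace E]

/-- Spherical caps of radius `ρ` have Hausdorff measure `O(ρ ^ m)`. -/
lemma exists_hausdorffMeasure_cap_le [FiniteDimensional ℝ E] (hE : Module.finrank ℝ E = m + 1)
    {e : E} (he : ‖e‖ = 1) :
    ∃ C : ℝ, ∀ ρ ∈ Ioc 0 √2,
      (μH[(m : ℝ)].restrict (sphere (0 : E) 1)) (closedBall e ρ) ≤
        ENNReal.ofReal (C * ρ ^ (m : ℝ)) := by
  have hv : ‖-e‖ = 1 := by rw [norm_neg, he]
  have hfin := finrank_orthogonal_singleton_of_norm_eq_one hE hv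
  have hHaar : (μH[(m : ℝ)] : Measure (ℝ ∙ (-e))ᗮ).IsAddHaarMeasure := by
    rw [← hfin]; infer_instance
  set M := (μH[(m : ℝ)] : Measure (ℝ ∙ (-e))ᗮ) (closedBall 0 1) with hM
  have hMtop : M ≠ ⊤ := (isCompact_closedBall _ _).measure_lt_top.ne
  refine ⟨2 ^ m * M.toReal, fun ρ hρ => ?_⟩
  have hsub := sphere_inter_closedBall_subset_image_stereoInvFun hv hρ
  rw [neg_neg] at hsub
  rw [Measure.restrict_apply measurableSet_closedBall, inter_comm]
  calc μH[(m : ℝ)] (sphere (0 : E) 1 ∩ closedBall e ρ)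
      ≤ _ := measure_mono hsub
    _ ≤ μH[(m : ℝ)] (closedBall (0 : (ℝ ∙ (-e))ᗮ) (2 * ρ)) := by
        simpa using (lipschitzWith_stereoInvFun hv).hausdorffMeasure_image_le
          (Nat.cast_nonneg m) (closedBall (0 : (ℝ ∙ (-e))ᗮ) (2 * ρ))
    _ = ENNReal.ofReal ((2 * ρ) ^ m) * M := by
        rw [Measure.addHaar_closedBall' _ _ (by linarith [hρ.1]), hfin]
    _ = ENNReal.ofReal (2 ^ m * M.toReal * ρ ^ (m : ℝ)) := by
        have := hρ.1
        conv_lhs => rw [← ENNReal.ofReal_toReal hMtop]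
        rw [← ENNReal.ofReal_mul (by positivity), Real.rpow_natCast]
        congr 1
        ring

lemma hausdorffMeasure_sphere_diff_poles_pos [FiniteDimensional ℝ E]
    (hE : Module.finrank ℝ E = m + 1) (hm : 1 ≤ m) {e : E} (he : ‖e‖ = 1) :
    0 < μH[(m : ℝ)] (sphere (0 : E) 1 \ {e, -e}) := by
  have hfin := finrank_orthogonal_singleton_of_norm_eq_one hE he
  have hHaar : (μH[(m : ℝ)] : Measure (ℝ ∙ e)ᗮ).IsAddHaarMeasure := by
    rw [← hfin]; infer_instance
  have hnt : Nontrivial (ℝ ∙ e)ᗮ := Module.nontrivial_of_finrank_pos (R := ℝ) (by omega)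
  have hee : (ℝ ∙ e)ᗮ.orthogonalProjectionOnto e = 0 :=
    Submodule.orthogonalProjectionOnto_orthogonalComplement_singleton_eq_zero e
  have hopen : IsOpen (ball (0 : (ℝ ∙ e)ᗮ) 1 \ {0}) := isOpen_ball.sdiff isClosed_singleton
  have hne : (ball (0 : (ℝ ∙ e)ᗮ) 1 \ {0}).Nonempty := by
    obtain ⟨u, hu⟩ := exists_norm_eq (ℝ ∙ e)ᗮ (c := 1 / 2) (by norm_num)
    refine ⟨u, by rw [mem_ball_zero_iff, hu]; norm_num, ?_⟩
    rintro rfl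
    norm_num at hu
  refine (hopen.measure_pos μH[(m : ℝ)] hne).trans_le
    (le_trans (measure_mono ?_) (hausdorffMeasure_orthogonalProjectionOnto_le (ℝ ∙ e)ᗮ (m : ℝ)
      (sphere (0 : E) 1 \ {e, -e}) (Nat.cast_nonneg m)))
  rintro u ⟨hu1, hu0⟩
  have hu1 : ‖u‖ < 1 := by simpa using hu1
  have hproj : (ℝ ∙ e)ᗮ.orthogonalProjectionOnto ((u : E) + √(1 - ‖u‖ ^ 2) • e) = u := by
    rw [map_add, map_smul, hee, smul_zero, add_zero,
      Submodule.orthogonalProjectionOnto_mem_subspace_eq_self]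
  refine ⟨(u : E) + √(1 - ‖u‖ ^ 2) • e, ⟨?_, ?_⟩, hproj⟩
  · rw [mem_sphere_zero_iff_norm]
    have hue : ⟪(u : E), e⟫ = 0 := Submodule.mem_orthogonal_singleton_iff_inner_left.1 u.2
    have : ‖(u : E) + √(1 - ‖u‖ ^ 2) • e‖ ^ 2 = 1 := by
      rw [norm_add_sq_real, inner_smul_right, hue, norm_smul, he, Real.norm_eq_abs, mul_one,
        sq_abs, Real.sq_sqrt (by nlinarith [norm_nonneg u]), Submodule.coe_norm]
      ring
    exact (pow_eq_one_iff_of_nonneg (norm_nonneg _) two_ne_zero).1 this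
  · rintro (h | h)
    · exact hu0 (by rw [mem_singleton_iff, ← hproj, h, hee])
    · exact hu0 (by rw [mem_singleton_iff, ← hproj, mem_singleton_iff.1 h, map_neg, hee, neg_zero])

/-- The integral of a zonal function over the sphere does not depend on the axis. -/
lemma setLIntegral_sphere_inner_eq (d : ℝ) (F : ℝ → ℝ≥0∞) {e e' : E} (h : ‖e‖ = ‖e'‖) :
    ∫⁻ σ in sphere (0 : E) 1, F ⟪σ, e'⟫ ∂μH[d] = ∫⁻ σ in sphere (0 : E) 1, F ⟪σ, e⟫ ∂μH[d] := by
  set R := (ℝ ∙ (e - e'))ᗮ.reflection with hR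
  have hRe : R e = e' := Submodule.reflection_sub h
  have hpre : R ⁻¹' sphere (0 : E) 1 = sphere (0 : E) 1 := by
    ext x; simp
  have := (R.toIsometryEquiv.measurePreserving_hausdorffMeasure d).setLIntegral_comp_preimage_emb
    R.toHomeomorph.measurableEmbedding (fun σ => F ⟪σ, e'⟫) (sphere (0 : E) 1)
  rw [← this, ← hRe]
  simp only [LinearIsometryEquiv.coe_toIsometryEquiv, LinearIsometryEquiv.inner_map_map, hpre]

end Sphere

/-- A chord bound for powers on `[1, 2]`. -/
lemma exists_one_add_rpow_sub_one_le (p : ℝ) :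
    ∃ K : ℝ, 0 ≤ K ∧ ∀ y ∈ Icc (0 : ℝ) 1, (1 + y) ^ p - 1 ≤ K * y := by
  have hpow : ∀ n : ℕ, ∀ y ∈ Icc (0 : ℝ) 1, (1 + y) ^ n ≤ 1 + (2 ^ n - 1) * y := by
    intro n y hy
    induction n with
    | zero => simp
    | succ n ih =>
      have h1 : (1 : ℝ) ≤ 2 ^ n := one_le_pow₀ one_le_two
      calc (1 + y) ^ (n + 1) = (1 + y) ^ n * (1 + y) := pow_succ _ _
        _ ≤ (1 + (2 ^ n - 1) * y) * (1 + y) := mul_le_mul_of_nonneg_right ih (by linarith [hy.1])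
        _ ≤ 1 + (2 ^ (n + 1) - 1) * y := by
          have : (2 ^ n - 1) * (y * y) ≤ (2 ^ n - 1) * (y : ℝ) :=
            mul_le_mul_of_nonneg_left (by nlinarith [hy.1, hy.2]) (by linarith)
          rw [pow_succ]
          linarith
  refine ⟨2 ^ ⌈p⌉₊ - 1, by linarith [one_le_pow₀ (M₀ := ℝ) one_le_two (n := ⌈p⌉₊)], fun y hy => ?_⟩
  have h1 : (1 + y) ^ p ≤ (1 + y) ^ ((⌈p⌉₊ : ℕ) : ℝ) :=
    Real.rpow_le_rpow_of_exponent_le (by linarith [hy.1]) (Nat.le_ceil p)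
  rw [Real.rpow_natCast] at h1
  linarith [hpow ⌈p⌉₊ y hy]

section Pointwise

variable {d γ ν C : ℝ} {b : ℝ → ℝ≥0∞}

/-- In the hemisphere `0 ≤ cos θ`, the integrand is controlled by a power of the distance
`√(2 - 2 cos θ)` to the pole `θ = 0`. -/
lemma exists_bound_near_pole (p : ℝ) (hd : 0 ≤ d) (hν : 0 < ν) (hC : 0 ≤ C)
    (hb : ∀ θ ∈ Ioo (0 : ℝ) Real.pi, 0 ≤ Real.cos θ →
      b (Real.cos θ) ≤ ENNReal.ofReal (C * θ ^ (-d - ν))) :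
    ∃ K : ℝ, 0 ≤ K ∧ ∀ t ∈ Ico (0 : ℝ) 1, ∀ x > 0, x ^ 2 = 2 - 2 * t →
      ENNReal.ofReal ((2 : ℝ) ^ p * (1 + t) ^ (-p) - 1) * b t ≤
        ENNReal.ofReal (K * x ^ ((2 - ν) - d)) := by
  obtain ⟨K, hK, hKle⟩ := exists_one_add_rpow_sub_one_le p
  refine ⟨K * C, by positivity, fun t ht x hx hxt => ?_⟩
  have h1t : 0 < 1 + t := by linarith [ht.1]
  have hpow : (2 : ℝ) ^ p * (1 + t) ^ (-p) - 1 ≤ K * x ^ 2 := by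
    have hy : (1 - t) / (1 + t) ≤ 1 - t := div_le_self (by linarith [ht.2]) (by linarith [ht.1])
    have hy0 : 0 ≤ (1 - t) / (1 + t) := div_nonneg (by linarith [ht.2]) h1t.le
    have heq : (2 : ℝ) ^ p * (1 + t) ^ (-p) = (1 + (1 - t) / (1 + t)) ^ p := by
      rw [Real.rpow_neg h1t.le, ← div_eq_mul_inv, ← Real.div_rpow zero_le_two h1t.le]
      congr 1
      field_simp
      ring
    rw [heq]
    refine (hKle _ ⟨hy0, by linarith [ht.1]⟩).trans (mul_le_mul_of_nonneg_left ?_ hK)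
    linarith [ht.2]
  have hθ0 : 0 < Real.arccos t := Real.arccos_pos.2 ht.2
  have hcos : Real.cos (Real.arccos t) = t := Real.cos_arccos (by linarith [ht.1]) ht.2.le
  have hθπ : Real.arccos t < Real.pi := by
    have := Real.arccos_le_pi_div_two.2 ht.1
    linarith [Real.pi_pos]
  have hxθ : x ≤ Real.arccos t := by
    refine le_of_sq_le_sq ?_ hθ0.le
    have := Real.one_sub_sq_div_two_le_cos (x := Real.arccos t)
    rw [hcos] at this
    linarith
  have hbt := hb _ ⟨hθ0, hθπ⟩ (by rw [hcos]; exact ht.1)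
  rw [hcos] at hbt
  have hbt' : b t ≤ ENNReal.ofReal (C * x ^ (-d - ν)) :=
    hbt.trans (ENNReal.ofReal_le_ofReal (mul_le_mul_of_nonneg_left
      (Real.rpow_le_rpow_of_nonpos hx hxθ (by linarith)) hC))
  calc _ ≤ ENNReal.ofReal (K * x ^ 2) * ENNReal.ofReal (C * x ^ (-d - ν)) :=
        mul_le_mul' (ENNReal.ofReal_le_ofReal hpow) hbt'
    _ = ENNReal.ofReal (K * C * x ^ ((2 - ν) - d)) := by
        rw [← ENNReal.ofReal_mul (by positivity), show 2 - ν - d = 2 + (-d - ν) by ring,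
          Real.rpow_add hx, Real.rpow_two]
        congr 1
        ring

/-- In the hemisphere `cos θ < 0`, the integrand is controlled by a power of the distance
`√(2 + 2 cos θ)` to the pole `θ = π`. -/
lemma exists_bound_near_antipode (hC : 0 ≤ C)
    (hb : ∀ θ ∈ Ioo (0 : ℝ) Real.pi, Real.cos θ < 0 →
      b (Real.cos θ) ≤ ENNReal.ofReal (C * Real.sin θ ^ (γ + ν + 1))) :
    ∃ K : ℝ, 0 ≤ K ∧ ∀ t ∈ Ioo (-1 : ℝ) 0, ∀ x > 0, x ^ 2 = 2 + 2 * t →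
      ENNReal.ofReal
          ((2 : ℝ) ^ ((d + 1 + γ) / 2) * (1 + t) ^ (-((d + 1 + γ) / 2)) - 1) * b t ≤
        ENNReal.ofReal (K * x ^ (ν - d)) := by
  refine ⟨4 ^ ((d + 1 + γ) / 2) * (C * 2 ^ |γ + ν + 1|), by positivity, fun t ht x hx hxt => ?_⟩
  set p := (d + 1 + γ) / 2 with hp
  set a := γ + ν + 1 with ha
  have hpow : (2 : ℝ) ^ p * (1 + t) ^ (-p) - 1 ≤ 4 ^ p * x ^ (-(2 * p)) := by
    have h1 : 1 + t = x ^ 2 / 2 := by linarith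
    have h2 : (2 : ℝ) ^ p * (1 + t) ^ (-p) = 4 ^ p * x ^ (-(2 * p)) := by
      rw [h1, Real.div_rpow (by positivity) zero_le_two, ← Real.rpow_two, ← Real.rpow_mul hx.le,
        Real.rpow_neg zero_le_two, show (4 : ℝ) = 2 * 2 by norm_num,
        Real.mul_rpow zero_le_two zero_le_two, div_inv_eq_mul, mul_neg]
      ring
    linarith
  have hcos : Real.cos (Real.arccos t) = t := Real.cos_arccos ht.1.le (by linarith [ht.2])
  have hθ0 : 0 < Real.arccos t := Real.arccos_pos.2 (by linarith [ht.2])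
  have hθπ : Real.arccos t < Real.pi := by
    refine lt_of_le_of_ne (Real.arccos_le_pi t) fun h => ?_
    rw [h, Real.cos_pi] at hcos
    linarith [ht.1]
  have hsin0 : 0 < Real.sin (Real.arccos t) := Real.sin_pos_of_pos_of_lt_pi hθ0 hθπ
  have hsin : Real.sin (Real.arccos t) ^ 2 = (1 - t) * (1 + t) := by
    rw [Real.sin_sq, hcos]; ring
  have hsin1 : Real.sin (Real.arccos t) ≤ x := by
    refine le_of_sq_le_sq ?_ hx.le
    nlinarith [ht.1, ht.2]
  have hsin2 : x / 2 ≤ Real.sin (Real.arccos t) := by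
    refine le_of_sq_le_sq ?_ hsin0.le
    nlinarith [ht.1, ht.2]
  have hbt := hb _ ⟨hθ0, hθπ⟩ (by rw [hcos]; exact ht.2)
  rw [hcos] at hbt
  have hbt' : b t ≤ ENNReal.ofReal (C * (2 ^ |a| * x ^ a)) :=
    hbt.trans (ENNReal.ofReal_le_ofReal (mul_le_mul_of_nonneg_left
      (rpow_le_two_rpow_abs_mul hx hsin2 hsin1 _) hC))
  calc _ ≤ ENNReal.ofReal (4 ^ p * x ^ (-(2 * p))) * ENNReal.ofReal (C * (2 ^ |a| * x ^ a)) :=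
        mul_le_mul' (ENNReal.ofReal_le_ofReal hpow) hbt'
    _ = ENNReal.ofReal (4 ^ p * (C * 2 ^ |a|) * x ^ (ν - d)) := by
        rw [← ENNReal.ofReal_mul (by positivity), show ν - d = -(2 * p) + a by rw [hp, ha]; ring,
          Real.rpow_add hx (-(2 * p)) a]
        congr 1
        ring

/-- The kernel identity behind the change of variables in the relative velocity. -/
lemma rpow_mul_rescaled_rpow (N γ : ℝ) {r t : ℝ} (hr : 0 ≤ r) (ht : 0 < 1 + t) :
    (2 : ℝ) ^ (N / 2) * (1 + t) ^ (-(N / 2)) * (√2 * r / √(1 + t)) ^ γ =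
      2 ^ ((N + γ) / 2) * (1 + t) ^ (-((N + γ) / 2)) * r ^ γ := by
  rw [Real.div_rpow (by positivity) (by positivity), Real.mul_rpow (by positivity) hr,
    Real.sqrt_eq_rpow, Real.sqrt_eq_rpow, ← Real.rpow_mul zero_le_two, ← Real.rpow_mul ht.le,
    show (N + γ) / 2 = N / 2 + 1 / 2 * γ by ring, neg_add, Real.rpow_add zero_lt_two,
    Real.rpow_add ht, Real.rpow_neg ht.le (1 / 2 * γ)]
  ring

end Pointwise

section Integrand

variable {m : ℕ} {γ ν C : ℝ} {b : ℝ → ℝ≥0∞} {e : EuclideanSpace ℝ (Fin (m + 1))}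

lemma inner_mem_Ioo_of_notMem_poles {E : Type*} [NormedAddCommGroup E] [InnerProductSpace ℝ E]
    {σ e : E} (hσ : ‖σ‖ = 1) (he : ‖e‖ = 1) (h : σ ∉ ({e, -e} : Set E)) :
    ⟪σ, e⟫ ∈ Ioo (-1 : ℝ) 1 := by
  rw [mem_insert_iff, mem_singleton_iff, not_or] at h
  refine ⟨?_, (inner_lt_one_iff_real_of_norm_eq_one hσ he).2 h.1⟩
  have := (inner_lt_one_iff_real_of_norm_eq_one hσ (by rwa [norm_neg])).2 h.2
  rw [inner_neg_right] at this
  linarith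

lemma measurable_cancellationIntegrand (N : ℕ) (γ : ℝ) (hbm : Measurable b)
    (e : EuclideanSpace ℝ (Fin N)) : Measurable (cancellationIntegrand N γ b e) := by
  have hi : Measurable fun σ : EuclideanSpace ℝ (Fin N) => (⟪σ, e⟫ : ℝ) :=
    (continuous_id.inner continuous_const).measurable
  refine Measurable.mul ?_ (hbm.comp hi)
  exact ((((hi.const_add 1).pow_const _).const_mul _).sub_const 1).ennreal_ofReal

lemma cancellationIntegrand_pole (he : ‖e‖ = 1) : cancellationIntegrand (m + 1) γ b e e = 0 := by
  rw [cancellationIntegrand, real_inner_self_eq_norm_sq, he, one_pow, one_add_one_eq_two,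
    ← Real.rpow_add zero_lt_two, add_neg_cancel, Real.rpow_zero, sub_self, ENNReal.ofReal_zero,
    zero_mul]

lemma cancellationIntegrand_antipode (he : ‖e‖ = 1) (hγ : 0 < (((m + 1 : ℕ) : ℝ) + γ) / 2) :
    cancellationIntegrand (m + 1) γ b e (-e) = 0 := by
  rw [cancellationIntegrand, inner_neg_left, real_inner_self_eq_norm_sq, he, one_pow,
    add_neg_cancel, Real.zero_rpow (by linarith), mul_zero, zero_sub,
    ENNReal.ofReal_of_nonpos (by norm_num), zero_mul]

lemma setLIntegral_cancellationIntegrand_pos (hm : 1 ≤ m) (hγ : 0 < (((m + 1 : ℕ) : ℝ) + γ) / 2)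
    (hbm : Measurable b) (hbpos : ∀ t ∈ Ioo (-1 : ℝ) 1, 0 < b t) (he : ‖e‖ = 1) :
    0 < ∫⁻ σ in sphere (0 : EuclideanSpace ℝ (Fin (m + 1))) 1,
      cancellationIntegrand (m + 1) γ b e σ ∂μH[(m : ℝ)] := by
  rw [setLIntegral_pos_iff (measurable_cancellationIntegrand _ _ hbm e)]
  refine (hausdorffMeasure_sphere_diff_poles_pos (by simp) hm he).trans_le
    (measure_mono fun σ hσ => ⟨?_, hσ.1⟩)
  have ht := inner_mem_Ioo_of_notMem_poles (by simpa using hσ.1) he hσ.2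
  have h1 : 0 < 1 + ⟪σ, e⟫ := by linarith [ht.1]
  refine (ENNReal.mul_pos (ENNReal.ofReal_pos.2 ?_).ne' (hbpos _ ht).ne').ne'
  rw [Real.rpow_neg h1.le, ← div_eq_mul_inv, ← Real.div_rpow zero_le_two h1.le, sub_pos]
  exact Real.one_lt_rpow ((one_lt_div h1).2 (by linarith [ht.2])) hγ

lemma setLIntegral_cancellationIntegrand_lt_top (hγ : 0 < (((m + 1 : ℕ) : ℝ) + γ) / 2)
    (hν : ν ∈ Ioo (0 : ℝ) 2) (hC : 0 ≤ C)
    (hb₁ : ∀ θ ∈ Ioo (0 : ℝ) Real.pi, 0 ≤ Real.cos θ →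
      b (Real.cos θ) ≤ ENNReal.ofReal (C * θ ^ (-(m : ℝ) - ν)))
    (hb₂ : ∀ θ ∈ Ioo (0 : ℝ) Real.pi, Real.cos θ < 0 →
      b (Real.cos θ) ≤ ENNReal.ofReal (C * Real.sin θ ^ (γ + ν + 1))) (he : ‖e‖ = 1) :
    ∫⁻ σ in sphere (0 : EuclideanSpace ℝ (Fin (m + 1))) 1,
      cancellationIntegrand (m + 1) γ b e σ ∂μH[(m : ℝ)] < ⊤ := by
  have he' : ‖-e‖ = 1 := by rw [norm_neg, he]
  set S : Set (EuclideanSpace ℝ (Fin (m + 1))) := sphere 0 1 with hS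
  set P : Set (EuclideanSpace ℝ (Fin (m + 1))) := {e, -e} with hP
  set μ := (μH[(m : ℝ)] : Measure (EuclideanSpace ℝ (Fin (m + 1)))).restrict S with hμ
  have hi : Measurable fun σ : EuclideanSpace ℝ (Fin (m + 1)) => (⟪σ, e⟫ : ℝ) :=
    (continuous_id.inner continuous_const).measurable
  have hSm : MeasurableSet S := isClosed_sphere.measurableSet
  have hPm : MeasurableSet P := (toFinite P).measurableSet
  set A₁ := (S \ P) ∩ {σ | 0 ≤ ⟪σ, e⟫} with hA₁
  set A₂ := (S \ P) ∩ {σ | ⟪σ, e⟫ < 0} with hA₂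
  have hA₁m : MeasurableSet A₁ := (hSm.diff hPm).inter (measurableSet_le measurable_const hi)
  have hA₂m : MeasurableSet A₂ := (hSm.diff hPm).inter (measurableSet_lt hi measurable_const)
  have hdist : ∀ σ ∈ S \ P, dist σ e ^ 2 = 2 - 2 * ⟪σ, e⟫ ∧ dist σ (-e) ^ 2 = 2 + 2 * ⟪σ, e⟫ := by
    intro σ hσ
    have h1 : ‖σ‖ = 1 := by simpa [hS] using hσ.1
    refine ⟨dist_sq_eq_two_sub_inner h1 he, ?_⟩
    rw [dist_sq_eq_two_sub_inner h1 he', inner_neg_right]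
    ring
  have hinner : ∀ σ ∈ S \ P, ⟪σ, e⟫ ∈ Ioo (-1 : ℝ) 1 := fun σ hσ =>
    inner_mem_Ioo_of_notMem_poles (by simpa [hS] using hσ.1) he hσ.2
  have hcap₁ : ∀ σ ∈ A₁, dist σ e ∈ Ioc 0 √2 := fun σ hσ =>
    ⟨dist_pos.2 fun h => hσ.1.2 (Or.inl h), Real.le_sqrt_of_sq_le (by
      have h : (0 : ℝ) ≤ ⟪σ, e⟫ := hσ.2
      linarith [(hdist σ hσ.1).1])⟩
  have hcap₂ : ∀ σ ∈ A₂, dist σ (-e) ∈ Ioc 0 √2 := fun σ hσ =>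
    ⟨dist_pos.2 fun h => hσ.1.2 (Or.inr h), Real.le_sqrt_of_sq_le (by
      have h : (⟪σ, e⟫ : ℝ) < 0 := hσ.2
      linarith [(hdist σ hσ.1).2])⟩
  obtain ⟨C₁, hC₁⟩ := exists_hausdorffMeasure_cap_le (m := m) (by simp) he
  obtain ⟨C₂, hC₂⟩ := exists_hausdorffMeasure_cap_le (m := m) (by simp) he'
  obtain ⟨K₁, hK₁, hf₁⟩ := exists_bound_near_pole ((((m + 1 : ℕ) : ℝ) + γ) / 2)
    (Nat.cast_nonneg m) hν.1 hC hb₁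
  obtain ⟨K₂, hK₂, hf₂⟩ := exists_bound_near_antipode (d := (m : ℝ)) hC hb₂
  have hint₁ : ∫⁻ σ in A₁, cancellationIntegrand (m + 1) γ b e σ ∂μ < ⊤ :=
    setLIntegral_lt_top_of_le_dist_rpow (by positivity) hK₁ (sub_pos.2 hν.2) hC₁ hA₁m hcap₁
      fun σ hσ => hf₁ _ ⟨hσ.2, (hinner σ hσ.1).2⟩ _ (hcap₁ σ hσ).1 (hdist σ hσ.1).1
  have hint₂ : ∫⁻ σ in A₂, cancellationIntegrand (m + 1) γ b e σ ∂μ < ⊤ := by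
    refine setLIntegral_lt_top_of_le_dist_rpow (by positivity) hK₂ hν.1 hC₂ hA₂m hcap₂
      fun σ hσ => ?_
    have := hf₂ _ ⟨(hinner σ hσ.1).1, hσ.2⟩ _ (hcap₂ σ hσ).1 (hdist σ hσ.1).2
    rwa [← Nat.cast_add_one] at this
  have hint₀ : ∫⁻ σ in P, cancellationIntegrand (m + 1) γ b e σ ∂μ = 0 := by
    rw [setLIntegral_congr_fun hPm (g := fun _ => 0), lintegral_zero]
    rintro σ (rfl | rfl)
    exacts [cancellationIntegrand_pole he, cancellationIntegrand_antipode he hγ]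
  have hcover : S ⊆ P ∪ (A₁ ∪ A₂) := by
    intro σ hσ
    by_cases hσP : σ ∈ P
    · exact Or.inl hσP
    · exact Or.inr ((le_or_gt 0 (⟪σ, e⟫ : ℝ)).imp (fun h => ⟨⟨hσ, hσP⟩, h⟩)
        fun h => ⟨⟨hσ, hσP⟩, h⟩)
  calc ∫⁻ σ in S, cancellationIntegrand (m + 1) γ b e σ ∂μH[(m : ℝ)]
      = ∫⁻ σ in S, cancellationIntegrand (m + 1) γ b e σ ∂μ := by
        rw [hμ, Measure.restrict_restrict hSm, inter_self]
    _ ≤ ∫⁻ σ in P ∪ (A₁ ∪ A₂), cancellationIntegrand (m + 1) γ b e σ ∂μ :=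
        lintegral_mono_set hcover
    _ ≤ _ := lintegral_union_le _ _ _
    _ < ⊤ := by
        rw [hint₀, zero_add]
        exact (lintegral_union_le _ _ _).trans_lt (ENNReal.add_lt_top.2 ⟨hint₁, hint₂⟩)

/-- The integrand of the change-of-variables formula is the cancellation integrand times `r ^ γ`,
the poles included. -/
lemma rescaled_sub_eq_cancellationIntegrand_mul (hγ : 0 < (((m + 1 : ℕ) : ℝ) + γ) / 2)
    (hbtop : ∀ t ∈ Ioo (-1 : ℝ) 1, b t ≠ ⊤) (he : ‖e‖ = 1) {r : ℝ} (hr : 0 < r)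
    {σ : EuclideanSpace ℝ (Fin (m + 1))} (hσ : ‖σ‖ = 1) :
    ENNReal.ofReal
        ((2 : ℝ) ^ (((m + 1 : ℕ) : ℝ) / 2) * (1 + ⟪σ, e⟫) ^ (-(((m + 1 : ℕ) : ℝ) / 2)) *
          (√2 * r / √(1 + ⟪σ, e⟫)) ^ γ) * b ⟪σ, e⟫ - ENNReal.ofReal (r ^ γ) * b ⟪σ, e⟫ =
      cancellationIntegrand (m + 1) γ b e σ * ENNReal.ofReal (r ^ γ) := by
  have hee : (⟪e, e⟫ : ℝ) = 1 := by rw [real_inner_self_eq_norm_sq, he, one_pow]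
  by_cases hP : σ ∈ ({e, -e} : Set _)
  · rcases hP with rfl | hσe
    · rw [cancellationIntegrand_pole he, zero_mul,
        rpow_mul_rescaled_rpow _ _ hr.le (by rw [hee]; norm_num), hee, one_add_one_eq_two,
        ← Real.rpow_add zero_lt_two, add_neg_cancel, Real.rpow_zero, one_mul, tsub_self]
    · rw [mem_singleton_iff] at hσe
      subst hσe
      rw [cancellationIntegrand_antipode he hγ, zero_mul, inner_neg_left, hee, add_neg_cancel,
        Real.zero_rpow (neg_ne_zero.2 (by positivity)), mul_zero, zero_mul, ENNReal.ofReal_zero,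
        zero_mul, zero_tsub]
  · have ht := inner_mem_Ioo_of_notMem_poles hσ he hP
    rw [rpow_mul_rescaled_rpow _ _ hr.le (by linarith [ht.1]), cancellationIntegrand,
      ← ENNReal.sub_mul fun _ _ => hbtop _ ht, ← ENNReal.ofReal_sub _ (by positivity),
      mul_right_comm (ENNReal.ofReal _) (b _), ← ENNReal.ofReal_mul' (by positivity), sub_mul, one_mul]

end Integrand

/-- **The cancellation lemma computation** (Lemmas 5.1 and 5.2 of the paper). For a
non-cutoff cross section `B(r,θ) = r^γ b(cos θ)`, the integral
`I = ∫_{S^{N-1}} (2^{(N+γ)/2}(1+σ·e)^{-(N+γ)/2} − 1) b(σ·e) dσ` is finite and positive,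
does not depend on the unit vector `e`, and for every `r > 0`,
`∫_{S^{N-1}} (2^{N/2}(1+σ·e)^{-N/2} B(√2 r/√(1+σ·e), θ) − B(r,θ)) dσ = I r^γ`,
where `cos θ = σ·e`; so `B̃(r) = I r^γ`. -/
theorem cancellation_lemma_integral
    (N : ℕ) (hN : 2 ≤ N) (γ ν C_b : ℝ)
    (hγ : -(N : ℝ) < γ) (hν : ν ∈ Ioo (0:ℝ) 2) (hC_b : 1 ≤ C_b)
    (b : ℝ → ℝ≥0∞) (hbm : Measurable b)
    (hb : ∀ θ ∈ Ioo (0:ℝ) Real.pi,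
      (0 ≤ Real.cos θ →
        ENNReal.ofReal (C_b⁻¹ * θ ^ (-((N : ℝ) - 1) - ν)) ≤ b (Real.cos θ) ∧
        b (Real.cos θ) ≤ ENNReal.ofReal (C_b * θ ^ (-((N : ℝ) - 1) - ν))) ∧
      (Real.cos θ < 0 →
        ENNReal.ofReal (C_b⁻¹ * Real.sin θ ^ (γ + ν + 1)) ≤ b (Real.cos θ) ∧
        b (Real.cos θ) ≤ ENNReal.ofReal (C_b * Real.sin θ ^ (γ + ν + 1))))
    (e : EuclideanSpace ℝ (Fin N)) (he : e ∈ sphere (0 : EuclideanSpace ℝ (Fin N)) 1) :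
    0 < (∫⁻ σ in sphere (0 : EuclideanSpace ℝ (Fin N)) 1,
        cancellationIntegrand N γ b e σ ∂(μH[(N : ℝ) - 1])) ∧
    (∫⁻ σ in sphere (0 : EuclideanSpace ℝ (Fin N)) 1,
        cancellationIntegrand N γ b e σ ∂(μH[(N : ℝ) - 1])) < ⊤ ∧
    (∀ e' ∈ sphere (0 : EuclideanSpace ℝ (Fin N)) 1,
      (∫⁻ σ in sphere (0 : EuclideanSpace ℝ (Fin N)) 1,
          cancellationIntegrand N γ b e' σ ∂(μH[(N : ℝ) - 1])) =
        ∫⁻ σ in sphere (0 : EuclideanSpace ℝ (Fin N)) 1,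
          cancellationIntegrand N γ b e σ ∂(μH[(N : ℝ) - 1])) ∧
    ∀ r > (0:ℝ),
      (∫⁻ σ in sphere (0 : EuclideanSpace ℝ (Fin N)) 1,
          (ENNReal.ofReal
              ((2 : ℝ) ^ ((N : ℝ) / 2) * (1 + ⟪σ, e⟫) ^ (-((N : ℝ) / 2)) *
                (Real.sqrt 2 * r / Real.sqrt (1 + ⟪σ, e⟫)) ^ γ) * b ⟪σ, e⟫ -
            ENNReal.ofReal (r ^ γ) * b ⟪σ, e⟫) ∂(μH[(N : ℝ) - 1])) =
        (∫⁻ σ in sphere (0 : EuclideanSpace ℝ (Fin N)) 1,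
            cancellationIntegrand N γ b e σ ∂(μH[(N : ℝ) - 1])) *
          ENNReal.ofReal (r ^ γ) := by
  obtain ⟨m, rfl⟩ : ∃ m, N = m + 1 := ⟨N - 1, by omega⟩
  have hm : ((m + 1 : ℕ) : ℝ) - 1 = m := by push_cast; ring
  rw [hm] at hb ⊢
  have hp : 0 < (((m + 1 : ℕ) : ℝ) + γ) / 2 := by linarith
  have he1 : ‖e‖ = 1 := by simpa using he
  have hC : 0 < C_b := by linarith
  have hbt : ∀ t ∈ Ioo (-1 : ℝ) 1, 0 < b t ∧ b t ≠ ⊤ := by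
    intro t ht
    have hcos : Real.cos (Real.arccos t) = t := Real.cos_arccos ht.1.le ht.2.le
    have hθ0 : 0 < Real.arccos t := Real.arccos_pos.2 ht.2
    have hθπ : Real.arccos t < Real.pi := by
      refine lt_of_le_of_ne (Real.arccos_le_pi t) fun h => ?_
      rw [h, Real.cos_pi] at hcos
      linarith [ht.1]
    have hsin := Real.sin_pos_of_pos_of_lt_pi hθ0 hθπ
    have h := hb _ ⟨hθ0, hθπ⟩
    rw [hcos] at h
    rcases le_or_gt 0 t with h0 | h0
    · exact ⟨(ENNReal.ofReal_pos.2 (by positivity)).trans_le (h.1 h0).1,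
        ((h.1 h0).2.trans_lt ENNReal.ofReal_lt_top).ne⟩
    · exact ⟨(ENNReal.ofReal_pos.2 (by positivity)).trans_le (h.2 h0).1,
        ((h.2 h0).2.trans_lt ENNReal.ofReal_lt_top).ne⟩
  refine ⟨setLIntegral_cancellationIntegrand_pos (by omega) hp hbm (fun t ht => (hbt t ht).1) he1,
    setLIntegral_cancellationIntegrand_lt_top hp hν hC.le (fun θ hθ h => ((hb θ hθ).1 h).2)
      (fun θ hθ h => ((hb θ hθ).2 h).2) he1, fun e' he' => ?_, fun r hr => ?_⟩
  · exact setLIntegral_sphere_inner_eq (m : ℝ)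
      (fun t => ENNReal.ofReal ((2 : ℝ) ^ ((((m + 1 : ℕ) : ℝ) + γ) / 2) *
        (1 + t) ^ (-((((m + 1 : ℕ) : ℝ) + γ) / 2)) - 1) * b t)
      (he1.trans (by simpa using he'.symm))
  · rw [← lintegral_mul_const _ (measurable_cancellationIntegrand _ _ hbm e)]
    exact setLIntegral_congr_fun isClosed_sphere.measurableSet fun σ hσ =>
      rescaled_sub_eq_cancellationIntegrand_mul hp (fun t ht => (hbt t ht).2) he1 hr
        (by simpa using hσ)
end
end
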